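/- arXiv:1208.3568 — 4 statements merged into one kernel-verified Lean document; each statement's English description precedes it below -/
import Mathlib

section
/- For all δ > 0 and every integer t ≥ 3 there exists n₀ = n₀(δ,t) such that the following holds for all n ≥ n₀: every (δ,n)-expander G on m vertices with 2^{log n/(log log n)²} ≤ m ≤ n satisfies at least one of: (1) G has t vertices v_1,…,v_t each of degree at least (log m)⁴; (2) setting γ = δ·log m/(5·log n), G contains t pairwise disjoint vertex sets S_1,…,S_t such that each induced subgraph G[S_i] is a γ-expanding ball, m^{1/5} ≤ |S_i| ≤ m^{1/4}, and every vertex of G[S_i] has degree at most (log m)⁴ in G[S_i]. -/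
open Real

/-- Edge density `d(G) = |E(G)|/|V(G)|`. -/
noncomputable def density {V : Type*} (G : SimpleGraph V) : ℝ :=
  G.edgeSet.ncard / Nat.card V

/-- External neighborhood `N(S)`: vertices outside `S` adjacent to some vertex of `S`. -/
def nbhd {V : Type*} (G : SimpleGraph V) (S : Set V) : Set V :=
  {v | v ∉ S ∧ ∃ u ∈ S, G.Adj u v}

/-- `G` contains a `K_t`-minor (branch sets are disjoint, nonempty, connected,
pairwise joined by an edge). -/
def HasKtMinor {V : Type*} (G : SimpleGraph V) (t : ℕ) : Prop :=
  ∃ P : Fin t → Set V,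
    (∀ i, (P i).Nonempty) ∧
    (Pairwise (Function.onFun Disjoint P)) ∧
    (∀ i, (G.induce (P i)).Connected) ∧
    (∀ i j : Fin t, i < j → ∃ u ∈ P i, ∃ v ∈ P j, G.Adj u v)

/-- `G` contains a `K_t`-minor of order at most `k`. -/
def HasKtMinorOfOrder {V : Type*} (G : SimpleGraph V) (t : ℕ) (k : ℝ) : Prop :=
  ∃ P : Fin t → Set V,
    (∀ i, (P i).Nonempty) ∧
    (Pairwise (Function.onFun Disjoint P)) ∧
    (∀ i, (G.induce (P i)).Connected) ∧
    (∀ i j : Fin t, i < j → ∃ u ∈ P i, ∃ v ∈ P j, G.Adj u v) ∧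
    ((⋃ i, P i).ncard : ℝ) ≤ k

/-- `c(t)`: the least `c` such that every graph of density at least `c` has a `K_t`-minor. -/
noncomputable def minorThreshold (t : ℕ) : ℝ :=
  sInf {c : ℝ | ∀ (n : ℕ) (G : SimpleGraph (Fin n)), density G ≥ c → HasKtMinor G t}

/-- `δ`-expander. -/
def IsDeltaExpander {V : Type*} (G : SimpleGraph V) (δ : ℝ) : Prop :=
  ∀ d : ℕ, (d : ℝ) ≤ logb 2 (logb 2 (Nat.card V)) - 1 →
    ∀ S : Set V, (S.ncard : ℝ) ≤ (Nat.card V : ℝ) / (2 : ℝ) ^ (2 ^ d : ℕ) →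
      ((nbhd G S).ncard : ℝ) ≥
        δ * 2 ^ d / (logb 2 (Nat.card V) * (logb 2 (logb 2 (Nat.card V))) ^ 2) * S.ncard

/-- `(δ, n)`-expander. -/
def IsDeltaNExpander {V : Type*} (G : SimpleGraph V) (δ : ℝ) (n : ℕ) : Prop :=
  ∀ d : ℕ, (d : ℝ) ≤ logb 2 (logb 2 (Nat.card V)) - 1 →
    ∀ S : Set V, (S.ncard : ℝ) ≤ (Nat.card V : ℝ) / (2 : ℝ) ^ (2 ^ d : ℕ) →
      ((nbhd G S).ncard : ℝ) ≥ δ * 2 ^ d / logb 2 n * S.ncard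

/-- `B_k(v)`: ball of radius `k` around the vertex `v`. -/
def gball {V : Type*} (G : SimpleGraph V) (v : V) (k : ℕ) : Set V :=
  {u | ∃ p : G.Walk v u, p.length ≤ k}

/-- `B_k(U)`: ball of radius `k` around the vertex set `U`. -/
def gballSet {V : Type*} (G : SimpleGraph V) (U : Set V) (k : ℕ) : Set V :=
  {v | ∃ u ∈ U, ∃ p : G.Walk u v, p.length ≤ k}

/-- A graph `H` is a `γ`-expanding ball: it is covered by a ball `B_k(v)` all of whose
intermediate balls expand by a factor `1 + γ`. -/
def GraphIsExpandingBall {V : Type*} (H : SimpleGraph V) (γ : ℝ) : Prop :=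
  ∃ (v : V) (k : ℕ), gball H v k = Set.univ ∧
    ∀ i : ℕ, 1 ≤ i → i + 1 ≤ k →
      ((gball H v (i + 1)).ncard : ℝ) ≥ (1 + γ) * (gball H v i).ncard

/-- The ball of radius `k` around `v` in the subgraph of `G` induced on `A ∪ {v}`. -/
def confinedBall {V : Type*} (G : SimpleGraph V) (A : Set V) (v : V) : ℕ → Set V
  | 0 => {v}
  | k + 1 => confinedBall G A v k ∪ (nbhd G (confinedBall G A v k) ∩ A)

lemma confinedBall_mono {V : Type*} (G : SimpleGraph V) (A : Set V) (v : V) :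
    Monotone (confinedBall G A v) :=
  monotone_nat_of_le_succ fun _ => Set.subset_union_left

lemma mem_confinedBall_self {V : Type*} (G : SimpleGraph V) (A : Set V) (v : V) (k : ℕ) :
    v ∈ confinedBall G A v k :=
  confinedBall_mono G A v (Nat.zero_le k) rfl

lemma confinedBall_subset {V : Type*} (G : SimpleGraph V) {A : Set V} {v : V} (hv : v ∈ A)
    (k : ℕ) : confinedBall G A v k ⊆ A := by
  induction k with
  | zero => simpa [confinedBall] using hv
  | succ k ih => exact Set.union_subset ih Set.inter_subset_right

lemma gball_zero {V : Type*} (H : SimpleGraph V) (v : V) : gball H v 0 = {v} := by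
  ext u
  constructor
  · rintro ⟨p, hp⟩
    exact (p.eq_of_length_eq_zero (Nat.le_zero.mp hp)).symm
  · rintro rfl
    exact ⟨.nil, le_rfl⟩

lemma gball_succ {V : Type*} (H : SimpleGraph V) (v : V) (k : ℕ) :
    gball H v (k + 1) = gball H v k ∪ nbhd H (gball H v k) := by
  ext u
  constructor
  · rintro ⟨p, hp⟩
    by_cases hu : u ∈ gball H v k
    · exact Or.inl hu
    · refine Or.inr ⟨hu, ?_⟩
      have hn : ¬ p.Nil := by
        intro hnil
        exact hu ⟨p, by simp [SimpleGraph.Walk.length_eq_zero_iff.mpr hnil]⟩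
      refine ⟨p.penultimate, ⟨p.dropLast, ?_⟩, p.adj_penultimate hn⟩
      have := p.length_dropLast_add_one hn
      omega
  · rintro (⟨p, hp⟩ | ⟨-, w, ⟨p, hp⟩, hw⟩)
    · exact ⟨p, by omega⟩
    · exact ⟨p.concat hw, by simpa using hp⟩

lemma gball_induce_confinedBall {V : Type*} (G : SimpleGraph V) {A : Set V} {v : V}
    (hv : v ∈ A) (k : ℕ) {i : ℕ} (hi : i ≤ k) :
    gball (G.induce (confinedBall G A v k)) ⟨v, mem_confinedBall_self G A v k⟩ i =
      Subtype.val ⁻¹' confinedBall G A v i := by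
  induction i with
  | zero =>
    rw [gball_zero]
    ext x
    simp [confinedBall, Subtype.ext_iff]
  | succ i ih =>
    rw [gball_succ, ih (by omega)]
    ext x
    have hxA : x.1 ∈ A := confinedBall_subset G hv k x.2
    have hsub : confinedBall G A v i ⊆ confinedBall G A v k :=
      confinedBall_mono G A v (by omega)
    constructor
    · rintro (hx | ⟨hx, u, hu, hux⟩)
      · exact Or.inl hx
      · exact Or.inr ⟨⟨hx, u.1, hu, hux⟩, hxA⟩
    · rintro (hx | ⟨⟨hx, u, hu, hux⟩, -⟩)
      · exact Or.inl hx
      · exact Or.inr ⟨hx, ⟨u, hsub hu⟩, hu, hux⟩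

lemma graphIsExpandingBall_confinedBall {V : Type*} (G : SimpleGraph V) {A : Set V} {v : V}
    (hv : v ∈ A) {k : ℕ} {γ : ℝ}
    (h : ∀ i : ℕ, 1 ≤ i → i + 1 ≤ k →
      (1 + γ) * (confinedBall G A v i).ncard ≤ (confinedBall G A v (i + 1)).ncard) :
    GraphIsExpandingBall (G.induce (confinedBall G A v k)) γ := by
  have hcard : ∀ i ≤ k, (gball (G.induce (confinedBall G A v k))
      ⟨v, mem_confinedBall_self G A v k⟩ i).ncard = (confinedBall G A v i).ncard := by
    intro i hi
    rw [gball_induce_confinedBall G hv k hi]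
    exact Set.ncard_preimage_of_injective_subset_range Subtype.val_injective
      (by simpa using confinedBall_mono G A v hi)
  refine ⟨⟨v, mem_confinedBall_self G A v k⟩, k, ?_, ?_⟩
  · rw [gball_induce_confinedBall G hv k le_rfl]
    ext x
    simp
  · intro i h1 hi
    rw [hcard i (by omega), hcard (i + 1) hi]
    exact h i h1 hi

lemma ncard_nbhd_le {V : Type*} [Finite V] (G : SimpleGraph V) (S : Set V) {D : ℝ}
    (hD : ∀ v ∈ S, ((G.neighborSet v).ncard : ℝ) ≤ D) :
    ((nbhd G S).ncard : ℝ) ≤ S.ncard * D := by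
  classical
  have := Fintype.ofFinite V
  have hsub : nbhd G S ⊆ (S.toFinset.biUnion fun v => (G.neighborSet v).toFinset : Finset V) := by
    rintro x ⟨-, u, hu, hux⟩
    simp only [Finset.coe_biUnion, Set.mem_iUnion]
    exact ⟨u, by simpa using hu, by simpa using hux⟩
  have h1 : (nbhd G S).ncard ≤ ∑ v ∈ S.toFinset, (G.neighborSet v).ncard := by
    refine (Set.ncard_le_ncard hsub (Set.toFinite _)).trans ?_
    rw [Set.ncard_coe_finset]
    refine Finset.card_biUnion_le.trans (le_of_eq ?_)
    exact Finset.sum_congr rfl fun v _ => (Set.ncard_eq_toFinset_card' _).symm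
  calc ((nbhd G S).ncard : ℝ) ≤ ∑ v ∈ S.toFinset, ((G.neighborSet v).ncard : ℝ) := by
        exact_mod_cast h1
    _ ≤ ∑ v ∈ S.toFinset, D := Finset.sum_le_sum fun v hv => hD v (by simpa using hv)
    _ = S.ncard * D := by rw [Finset.sum_const, nsmul_eq_mul, Set.ncard_eq_toFinset_card']

lemma ncard_confinedBall_succ {V : Type*} [Finite V] (G : SimpleGraph V) (A : Set V) (v : V)
    (k : ℕ) : (confinedBall G A v (k + 1)).ncard =
      (confinedBall G A v k).ncard + (nbhd G (confinedBall G A v k) ∩ A).ncard :=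
  Set.ncard_union_eq (Set.disjoint_left.mpr fun _ hx hx' => hx'.1.1 hx)

/-- In a confined region where small balls always expand, some ball reaches size `a` without
overshooting by more than a factor `1 + D`. -/
lemma exists_confinedBall_of_expanding {V : Type*} [Finite V] (G : SimpleGraph V) {A : Set V}
    {v : V} (hv : v ∈ A) {γ D a : ℝ} (hγ : 0 < γ) (ha : 1 < a)
    (hD : ∀ u ∈ A, ((G.neighborSet u).ncard : ℝ) ≤ D)
    (h : ∀ i : ℕ, 1 ≤ i → ((confinedBall G A v i).ncard : ℝ) < a →
      (1 + γ) * (confinedBall G A v i).ncard ≤ (confinedBall G A v (i + 1)).ncard) :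
    ∃ k, GraphIsExpandingBall (G.induce (confinedBall G A v k)) γ ∧
      a ≤ (confinedBall G A v k).ncard ∧ ((confinedBall G A v k).ncard : ℝ) ≤ (1 + D) * a := by
  classical
  have hpos : ∀ i, 0 < (confinedBall G A v i).ncard := fun i =>
    (Set.ncard_pos (Set.toFinite _)).mpr ⟨v, mem_confinedBall_self G A v i⟩
  have hex : ∃ k, a ≤ (confinedBall G A v k).ncard := by
    by_contra! hcon
    have hgrow : ∀ i : ℕ, i ≤ (confinedBall G A v (i + 1)).ncard := by
      intro i
      induction i with
      | zero => exact Nat.zero_le _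
      | succ i ih =>
        have h1 := h (i + 1) (by omega) (hcon _)
        have h2 : (0 : ℝ) < (confinedBall G A v (i + 1)).ncard := by exact_mod_cast hpos _
        have h3 : ((confinedBall G A v (i + 1)).ncard : ℝ) <
            (confinedBall G A v (i + 1 + 1)).ncard := by nlinarith [mul_pos hγ h2]
        have h4 : (confinedBall G A v (i + 1)).ncard < (confinedBall G A v (i + 1 + 1)).ncard := by
          exact_mod_cast h3
        omega
    have h1 := hcon (⌈a⌉₊ + 1)
    have h2 : ((⌈a⌉₊ : ℕ) : ℝ) ≤ (confinedBall G A v (⌈a⌉₊ + 1)).ncard := by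
      exact_mod_cast hgrow _
    linarith [Nat.le_ceil a]
  have hmin : ∀ i < Nat.find hex, ((confinedBall G A v i).ncard : ℝ) < a := fun i hi =>
    not_le.mp (Nat.find_min hex hi)
  refine ⟨Nat.find hex, ?_, Nat.find_spec hex, ?_⟩
  · exact graphIsExpandingBall_confinedBall G hv fun i h1 hi => h i h1 (hmin i (by omega))
  · obtain ⟨k, hk⟩ : ∃ k, Nat.find hex = k + 1 := by
      refine Nat.exists_eq_succ_of_ne_zero fun h0 => ?_
      have := Nat.find_spec hex
      rw [h0] at this
      simp [confinedBall] at this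
      linarith
    rw [hk, ncard_confinedBall_succ]
    have h1 := hmin k (by omega)
    have h2 := ncard_nbhd_le G (confinedBall G A v k)
      fun u hu => hD u (confinedBall_subset G hv k hu)
    have h3 : ((nbhd G (confinedBall G A v k) ∩ A).ncard : ℝ) ≤
        (nbhd G (confinedBall G A v k)).ncard := by
      exact_mod_cast Set.ncard_le_ncard Set.inter_subset_left (Set.toFinite _)
    have hD0 : 0 ≤ D := (Nat.cast_nonneg _).trans (hD v hv)
    push_cast
    nlinarith

/-- After deleting a small set `W`, a graph in which sets of size at most `s` expand still
contains an expanding ball of size between `a` and `b`. -/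
lemma exists_expandingBall_avoiding {V : Type*} [Finite V] (G : SimpleGraph V) (W : Set V)
    {γ D a b s w : ℝ} (hγ : 0 < γ)
    (hexp : ∀ U : Set V, (U.ncard : ℝ) ≤ s → 5 / 4 * γ * U.ncard ≤ (nbhd G U).ncard)
    (hdeg : ∀ v ∉ W, ((G.neighborSet v).ncard : ℝ) ≤ D) (ha : 1 < a) (hab : (1 + D) * a ≤ b)
    (hW : (W.ncard : ℝ) ≤ w) (hs : 4 * w / γ + a ≤ s) (hV : s + w < Nat.card V) :
    ∃ S : Set V, Disjoint S W ∧ GraphIsExpandingBall (G.induce S) γ ∧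
      a ≤ S.ncard ∧ (S.ncard : ℝ) ≤ b := by
  have hw0 : 0 ≤ w := (Nat.cast_nonneg _).trans hW
  let F : Set (Set V) := {U | Disjoint U W ∧ (U.ncard : ℝ) ≤ s ∧
    ((nbhd G U \ W).ncard : ℝ) ≤ γ * U.ncard}
  have hFne : (∅ : Set V) ∈ F := by
    have : nbhd G ∅ = ∅ := by ext; simp [nbhd]
    refine ⟨Set.empty_disjoint W, ?_, by simp [this]⟩
    have : 0 ≤ 4 * w / γ := by positivity
    simp only [Set.ncard_empty, Nat.cast_zero]
    linarith
  obtain ⟨U, ⟨hUW, hUs, hUN⟩, hUmax⟩ :=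
    Set.exists_max_image F Set.ncard (Set.toFinite F) ⟨∅, hFne⟩
  have hUsmall : (U.ncard : ℝ) ≤ 4 * w / γ := by
    have h1 := hexp U hUs
    have h2 : ((nbhd G U).ncard : ℝ) ≤ (nbhd G U \ W).ncard + W.ncard := by
      exact_mod_cast Set.ncard_le_ncard_sdiff_add_ncard _ _ (Set.toFinite _)
    rw [le_div_iff₀ hγ]
    nlinarith
  obtain ⟨v, hv⟩ : ∃ v, v ∈ (U ∪ W)ᶜ := by
    by_contra! hcon
    have huniv : U ∪ W = Set.univ := Set.eq_univ_of_forall fun x => not_not.mp (hcon x)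
    have h1 := Set.ncard_union_le U W
    rw [huniv, Set.ncard_univ] at h1
    have h2 : (Nat.card V : ℝ) ≤ U.ncard + W.ncard := by exact_mod_cast h1
    linarith
  have hA : ∀ u ∈ (U ∪ W)ᶜ, u ∉ W := fun u hu h => hu (Or.inr h)
  have hgrow : ∀ i : ℕ, 1 ≤ i → ((confinedBall G (U ∪ W)ᶜ v i).ncard : ℝ) < a →
      (1 + γ) * (confinedBall G (U ∪ W)ᶜ v i).ncard ≤
        (confinedBall G (U ∪ W)ᶜ v (i + 1)).ncard := by
    intro i _ hia
    by_contra! hcon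
    rw [ncard_confinedBall_succ] at hcon
    have hsub := confinedBall_subset G hv i
    have hself := mem_confinedBall_self G (U ∪ W)ᶜ v i
    generalize confinedBall G (U ∪ W)ᶜ v i = B at hia hcon hsub hself
    have hUB : Disjoint U B := Set.disjoint_left.mpr fun x hx hx' => hsub hx' (Or.inl hx)
    have hcard : (U ∪ B).ncard = U.ncard + B.ncard := Set.ncard_union_eq hUB
    have hBpos : 0 < B.ncard := (Set.ncard_pos (Set.toFinite _)).mpr ⟨v, hself⟩
    have hmem : U ∪ B ∈ F := by
      refine ⟨Set.disjoint_union_left.mpr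
        ⟨hUW, Set.disjoint_left.mpr fun x hx => hA x (hsub hx)⟩, ?_, ?_⟩
      · rw [hcard]
        push_cast
        linarith
      · have hN : nbhd G (U ∪ B) \ W ⊆ (nbhd G U \ W) ∪ (nbhd G B ∩ (U ∪ W)ᶜ) := by
          rintro x ⟨⟨hx, u, hu | hu, hux⟩, hxW⟩
          · exact Or.inl ⟨⟨fun h => hx (Or.inl h), u, hu, hux⟩, hxW⟩
          · exact Or.inr ⟨⟨fun h => hx (Or.inr h), u, hu, hux⟩,
              fun h => h.elim (fun h => hx (Or.inl h)) hxW⟩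
        have h1 : ((nbhd G (U ∪ B) \ W).ncard : ℝ) ≤
            (nbhd G U \ W).ncard + (nbhd G B ∩ (U ∪ W)ᶜ).ncard := by
          exact_mod_cast (Set.ncard_le_ncard hN (Set.toFinite _)).trans (Set.ncard_union_le _ _)
        rw [hcard]
        push_cast at hcon ⊢
        linarith
    have := hUmax _ hmem
    omega
  obtain ⟨k, hk, hka, hkb⟩ :=
    exists_confinedBall_of_expanding G hv hγ ha (fun u hu => hdeg u (hA u hu)) hgrow
  exact ⟨_, Set.disjoint_left.mpr fun x hx => hA x (confinedBall_subset G hv k hx), hk, hka,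
    hkb.trans hab⟩

/-- If every set containing `X` of size at most `|X| + t * b` can be avoided by a set with
property `P` of size at most `b`, then there are `t` disjoint such sets avoiding `X`. -/
lemma exists_pairwise_disjoint_family {V : Type*} [Finite V] (P : Set V → Prop) (X : Set V)
    (t : ℕ) {b : ℝ} (hb : 0 ≤ b) (hP : ∀ S, P S → (S.ncard : ℝ) ≤ b)
    (h : ∀ W, X ⊆ W → (W.ncard : ℝ) ≤ X.ncard + t * b → ∃ S, Disjoint S W ∧ P S) :
    ∃ S : Fin t → Set V, Pairwise (Function.onFun Disjoint S) ∧
      ∀ i, Disjoint (S i) X ∧ P (S i) := by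
  suffices hj : ∀ j ≤ t, ∃ S : Fin j → Set V, Pairwise (Function.onFun Disjoint S) ∧
      ∀ i, Disjoint (S i) X ∧ P (S i) from hj t le_rfl
  intro j hj
  induction j with
  | zero => exact ⟨Fin.elim0, fun i => i.elim0, fun i => i.elim0⟩
  | succ j ih =>
    obtain ⟨S, hS, hSP⟩ := ih (by omega)
    have hcard : ((X ∪ ⋃ i, S i).ncard : ℝ) ≤ X.ncard + t * b := by
      have h1 : ((X ∪ ⋃ i, S i).ncard : ℝ) ≤ X.ncard + (⋃ i, S i).ncard := by
        exact_mod_cast Set.ncard_union_le _ _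
      have h2 : ((⋃ i, S i).ncard : ℝ) ≤ ∑ i, ((S i).ncard : ℝ) := by
        exact_mod_cast Set.ncard_iUnion_le_of_fintype S
      have h3 : ∑ i, ((S i).ncard : ℝ) ≤ ∑ _i : Fin j, b :=
        Finset.sum_le_sum fun i _ => hP _ (hSP i).2
      have h4 : (j : ℝ) ≤ t := by exact_mod_cast (by omega : j ≤ t)
      simp only [Finset.sum_const, Finset.card_univ, Fintype.card_fin, nsmul_eq_mul] at h3
      linarith [mul_le_mul_of_nonneg_right h4 hb]
    obtain ⟨T, hTW, hT⟩ := h _ Set.subset_union_left hcard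
    have hTX := (Set.disjoint_union_right.mp hTW).1
    have hTS := Set.disjoint_iUnion_right.mp (Set.disjoint_union_right.mp hTW).2
    refine ⟨Fin.cons T S, ?_, Fin.cases ⟨hTX, hT⟩ hSP⟩
    intro i i'
    refine Fin.cases ?_ (fun i => ?_) i <;> refine Fin.cases ?_ (fun i' => ?_) i'
    · exact fun h => (h rfl).elim
    · exact fun _ => hTS i'
    · exact fun _ => (hTS i).symm
    · exact fun h => hS fun h' => h (congrArg Fin.succ h')

lemma ncard_lt_of_not_exists_injective {V : Type*} [Finite V] (X : Set V) (t : ℕ)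
    (h : ¬ ∃ v : Fin t → V, Function.Injective v ∧ ∀ i, v i ∈ X) : X.ncard < t := by
  by_contra! hcon
  obtain ⟨Y, hYX, hY⟩ := Set.exists_subset_card_eq hcon
  have e : Fin t ≃ Y := (Finite.equivFinOfCardEq hY).symm
  exact h ⟨fun i => e i, Subtype.val_injective.comp e.injective, fun i => hYX (e i).2⟩

/-- Sets of size at most `√m` in a `(δ, n)`-expander expand by `δ log m / (4 log n)`. -/
lemma IsDeltaNExpander.le_ncard_nbhd {m n : ℕ} {G : SimpleGraph (Fin m)} {δ : ℝ} (hδ : 0 < δ)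
    (hG : IsDeltaNExpander G δ n) (hm : 2 ≤ logb 2 m) (hn : 0 < logb 2 n) (U : Set (Fin m))
    (hU : (U.ncard : ℝ) ≤ (m : ℝ) ^ ((1 : ℝ) / 2)) :
    5 / 4 * (δ * logb 2 m / (5 * logb 2 n)) * U.ncard ≤ (nbhd G U).ncard := by
  have hm0 : (0 : ℝ) < m := by
    rcases Nat.eq_zero_or_pos m with rfl | h
    · simp at hm
      linarith
    · exact_mod_cast h
  set L := logb 2 (m : ℝ) with hL
  have hL0 : 0 < L := by linarith
  have hlogL : 1 ≤ logb 2 L := by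
    rw [Real.le_logb_iff_rpow_le one_lt_two hL0]
    simpa using hm
  set d := ⌊logb 2 L - 1⌋₊
  have hd1 : (d : ℝ) ≤ logb 2 L - 1 := Nat.floor_le (by linarith)
  have hd2 : logb 2 L - 1 < d + 1 := Nat.lt_floor_add_one _
  have hpow1 : (2 : ℝ) ^ d ≤ L / 2 := by
    have : (2 : ℝ) ^ ((d : ℝ) + 1) ≤ L := by
      rw [← Real.le_logb_iff_rpow_le one_lt_two hL0]
      linarith
    rw [Real.rpow_add two_pos, Real.rpow_natCast, Real.rpow_one] at this
    linarith
  have hpow2 : L / 4 ≤ (2 : ℝ) ^ d := by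
    have : L ≤ (2 : ℝ) ^ ((d : ℝ) + 2) := by
      rw [← Real.logb_le_iff_le_rpow one_lt_two hL0]
      linarith
    rw [Real.rpow_add two_pos, Real.rpow_natCast] at this
    norm_num at this
    linarith
  have hsize : (m : ℝ) ^ ((1 : ℝ) / 2) ≤ (m : ℝ) / (2 : ℝ) ^ (2 ^ d : ℕ) := by
    rw [le_div_iff₀ (by positivity)]
    have h1 : (2 : ℝ) ^ (2 ^ d : ℕ) ≤ (m : ℝ) ^ ((1 : ℝ) / 2) := by
      rw [← Real.rpow_natCast]
      calc (2 : ℝ) ^ ((2 ^ d : ℕ) : ℝ) ≤ (2 : ℝ) ^ (L * (1 / 2)) := by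
            apply Real.rpow_le_rpow_of_exponent_le one_le_two
            push_cast
            linarith
        _ = (m : ℝ) ^ ((1 : ℝ) / 2) := by
            rw [Real.rpow_mul zero_le_two, hL, Real.rpow_logb two_pos (by norm_num) hm0]
    calc (m : ℝ) ^ ((1 : ℝ) / 2) * (2 : ℝ) ^ (2 ^ d : ℕ)
        ≤ (m : ℝ) ^ ((1 : ℝ) / 2) * (m : ℝ) ^ ((1 : ℝ) / 2) := by gcongr
      _ = m := by rw [← Real.rpow_add hm0]; norm_num
  have hexp := hG d (by simpa using hd1) U (by simpa using hU.trans hsize)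
  refine le_trans ?_ hexp
  have : 5 / 4 * (δ * L / (5 * logb 2 n)) = δ * (L / 4) / logb 2 n := by
    field_simp
  rw [this]
  gcongr

lemma eventually_logb_le_rpow {s : ℝ} (hs : 0 < s) :
    ∀ᶠ x : ℝ in Filter.atTop, logb 2 x ≤ x ^ s := by
  have h := (isLittleO_log_rpow_atTop hs).bound (Real.log_pos one_lt_two)
  filter_upwards [h, Filter.eventually_ge_atTop 1] with x hx hx1
  have hx0 : (0 : ℝ) ≤ x ^ s := Real.rpow_nonneg (by linarith) s
  rw [Real.norm_of_nonneg hx0] at hx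
  rw [← Real.log_div_log, div_le_iff₀ (Real.log_pos one_lt_two), mul_comm]
  exact (le_abs_self _).trans hx

/-- The size estimates, valid for all large `m`, that make the greedy choice of balls work. -/
lemma eventually_size_estimates (δ : ℝ) (t : ℕ) : ∀ᶠ x : ℝ in Filter.atTop,
    2 ≤ logb 2 x ∧ 1 < x ^ ((1 : ℝ) / 5) ∧
    (1 + (logb 2 x) ^ 4) * x ^ ((1 : ℝ) / 5) ≤ x ^ ((1 : ℝ) / 4) ∧
    20 * logb 2 x * (t + t * x ^ ((1 : ℝ) / 4)) / δ + x ^ ((1 : ℝ) / 5) ≤ x ^ ((1 : ℝ) / 2) ∧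
    x ^ ((1 : ℝ) / 2) + (t + t * x ^ ((1 : ℝ) / 4)) < x := by
  have hε : (0 : ℝ) < 1 / 100 := by norm_num
  have hy := tendsto_rpow_atTop hε
  filter_upwards [eventually_logb_le_rpow hε, Filter.eventually_ge_atTop 0,
    (Real.tendsto_logb_atTop one_lt_two).eventually_ge_atTop 2, hy.eventually_ge_atTop 2,
    hy.eventually_ge_atTop (t : ℝ), hy.eventually_ge_atTop (20 * t / δ)] with x hL hx0 hL2 h2 ht htδ
  have hpow : ∀ k : ℕ, x ^ ((1 : ℝ) / 100 * k) = (x ^ ((1 : ℝ) / 100)) ^ k := fun k => by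
    rw [Real.rpow_mul hx0, Real.rpow_natCast]
  have h5 : x ^ ((1 : ℝ) / 5) = (x ^ ((1 : ℝ) / 100)) ^ 20 := by rw [← hpow]; norm_num
  have h4 : x ^ ((1 : ℝ) / 4) = (x ^ ((1 : ℝ) / 100)) ^ 25 := by rw [← hpow]; norm_num
  have hh : x ^ ((1 : ℝ) / 2) = (x ^ ((1 : ℝ) / 100)) ^ 50 := by rw [← hpow]; norm_num
  have h1 : x = (x ^ ((1 : ℝ) / 100)) ^ 100 := by rw [← hpow]; norm_num
  rw [h5, h4, hh]
  generalize logb 2 x = L at hL hL2 ⊢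
  generalize x ^ ((1 : ℝ) / 100) = y at hL h2 ht htδ h1 ⊢
  subst h1
  have hy1 : (1 : ℝ) ≤ y := by linarith
  have hdouble : ∀ i j : ℕ, i < j → 2 * y ^ i ≤ y ^ j := fun i j h => by
    refine le_trans ?_ (pow_le_pow_right₀ hy1 h)
    rw [Nat.succ_eq_add_one, pow_succ']
    gcongr
  have hone : ∀ i : ℕ, 1 ≤ y ^ i := fun i => one_le_pow₀ hy1
  have hsum : (t : ℝ) + t * y ^ 25 ≤ y ^ 27 := by
    calc (t : ℝ) + t * y ^ 25 = t * (1 + y ^ 25) := by ring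
      _ ≤ y * (y ^ 26) := by
          gcongr
          linarith [hdouble 25 26 (by norm_num), hone 25]
      _ = y ^ 27 := by ring
  refine ⟨hL2, one_lt_pow₀ (by linarith) (by norm_num), ?_, ?_, ?_⟩
  · calc (1 + L ^ 4) * y ^ 20 ≤ (1 + y ^ 4) * y ^ 20 := by gcongr
      _ ≤ y ^ 5 * y ^ 20 := by
          gcongr
          linarith [hdouble 4 5 (by norm_num), hone 4]
      _ = y ^ 25 := by ring
  · have h : 20 * L * (t + t * y ^ 25) / δ ≤ y ^ 28 := by
      calc 20 * L * (t + t * y ^ 25) / δ = 20 * t / δ * (L * (1 + y ^ 25)) := by ring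
        _ ≤ y * (y * y ^ 26) := by
            gcongr
            linarith [hdouble 25 26 (by norm_num), hone 25]
        _ = y ^ 28 := by ring
    linarith [hdouble 20 28 (by norm_num), hdouble 28 50 (by norm_num), hone 20, hone 28]
  · linarith [hdouble 27 50 (by norm_num), hdouble 50 100 (by norm_num), hone 27, hone 50]

lemma eventually_sqrt_logb_le : ∀ᶠ x : ℝ in Filter.atTop,
    Real.sqrt (logb 2 x) ≤ logb 2 x / (logb 2 (logb 2 x)) ^ 2 := by
  refine (Real.tendsto_logb_atTop one_lt_two).eventually
    (p := fun z => Real.sqrt z ≤ z / (logb 2 z) ^ 2) ?_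
  filter_upwards [eventually_logb_le_rpow (s := 1 / 4) (by norm_num),
    Filter.eventually_gt_atTop 1] with z hz hz1
  have hlog : 0 < logb 2 z := Real.logb_pos one_lt_two hz1
  have hz0 : 0 ≤ z := by linarith
  rw [le_div_iff₀ (by positivity)]
  have h1 : (logb 2 z) ^ 2 ≤ Real.sqrt z := by
    calc (logb 2 z) ^ 2 ≤ (z ^ ((1 : ℝ) / 4)) ^ 2 := by gcongr
      _ = Real.sqrt z := by
          rw [Real.sqrt_eq_rpow, ← Real.rpow_natCast, ← Real.rpow_mul hz0]
          norm_num
  calc Real.sqrt z * (logb 2 z) ^ 2 ≤ Real.sqrt z * Real.sqrt z := by gcongr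
    _ = z := Real.mul_self_sqrt hz0

/-- Claim 4.5: for large `n`, a `(δ,n)`-expander on `m` vertices with
`2^{log n/(log log n)²} ≤ m ≤ n` either has `t` vertices of degree at least `(log m)⁴`,
or it has `t` disjoint sets inducing `γ`-expanding balls of polynomial size with all
degrees at most `(log m)⁴`. -/
theorem stmt_12 :
    ∀ δ : ℝ, 0 < δ → ∀ t : ℕ, 3 ≤ t → ∃ n₀ : ℕ,
      ∀ n : ℕ, n₀ ≤ n → ∀ m : ℕ,
        (2 : ℝ) ^ (logb 2 n / (logb 2 (logb 2 n)) ^ 2) ≤ (m : ℝ) → m ≤ n →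
          ∀ G : SimpleGraph (Fin m), IsDeltaNExpander G δ n →
            (∃ v : Fin t → Fin m, Function.Injective v ∧
                ∀ i, ((G.neighborSet (v i)).ncard : ℝ) ≥ (logb 2 m) ^ 4) ∨
            (∃ S : Fin t → Set (Fin m),
                (Pairwise (Function.onFun Disjoint S)) ∧
                ∀ i, GraphIsExpandingBall (G.induce (S i)) (δ * logb 2 m / (5 * logb 2 n)) ∧
                  (m : ℝ) ^ ((1 : ℝ) / 5) ≤ ((S i).ncard : ℝ) ∧
                  ((S i).ncard : ℝ) ≤ (m : ℝ) ^ ((1 : ℝ) / 4) ∧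
                  ∀ x : (S i),
                    (((G.induce (S i)).neighborSet x).ncard : ℝ) ≤ (logb 2 m) ^ 4) := by
  intro δ hδ t _
  have hsqrt : Filter.Tendsto (fun x : ℝ => (2 : ℝ) ^ Real.sqrt (logb 2 x))
      Filter.atTop Filter.atTop :=
    (tendsto_rpow_atTop_of_base_gt_one 2 one_lt_two).comp
      (Real.tendsto_sqrt_atTop.comp (Real.tendsto_logb_atTop one_lt_two))
  have hev := tendsto_natCast_atTop_atTop.eventually <|
    (hsqrt.eventually (Filter.eventually_forall_ge_atTop.mpr
      (eventually_size_estimates δ t))).and eventually_sqrt_logb_le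
  obtain ⟨n₀, hn₀⟩ := Filter.eventually_atTop.mp hev
  refine ⟨n₀, fun n hn m hm hmn G hG => ?_⟩
  obtain ⟨hest, hlog⟩ := hn₀ n hn
  have hsm : (2 : ℝ) ^ Real.sqrt (logb 2 n) ≤ m :=
    (Real.rpow_le_rpow_of_exponent_le one_le_two hlog).trans hm
  obtain ⟨hL2, ha, hab, hs, hV⟩ := hest m hsm
  have hm0 : (0 : ℝ) < m := lt_of_lt_of_le (by positivity) hsm
  have hLn : logb 2 m ≤ logb 2 n :=
    Real.logb_le_logb_of_le one_lt_two hm0 (by exact_mod_cast hmn)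
  have hN0 : 0 < logb 2 n := by linarith
  have hNL : logb 2 n ≤ logb 2 m * logb 2 m := by
    have h1 : Real.sqrt (logb 2 n) ≤ logb 2 m :=
      (Real.le_logb_iff_rpow_le one_lt_two hm0).mpr hsm
    rw [← Real.mul_self_sqrt hN0.le]
    gcongr
  rw [or_iff_not_imp_left]
  intro hdeg
  set X : Set (Fin m) := {v | (logb 2 m) ^ 4 ≤ ((G.neighborSet v).ncard : ℝ)}
  have hXt : (X.ncard : ℝ) ≤ t := by
    exact_mod_cast (ncard_lt_of_not_exists_injective X t hdeg).le
  have hXdeg : ∀ v ∉ X, ((G.neighborSet v).ncard : ℝ) ≤ (logb 2 m) ^ 4 :=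
    fun v hv => (not_le.mp hv).le
  set γ := δ * logb 2 m / (5 * logb 2 n) with hγdef
  have hL0 : 0 < logb 2 (m : ℝ) := by linarith
  have hγ : 0 < γ := by positivity
  set w : ℝ := t + t * (m : ℝ) ^ ((1 : ℝ) / 4)
  have hwγ : 4 * w / γ ≤ 20 * logb 2 m * w / δ := by
    have hw0 : 0 ≤ w := by positivity
    rw [div_le_div_iff₀ hγ hδ]
    have h1 : 20 * logb 2 m * w * γ = 4 * w * δ * (logb 2 m * logb 2 m / logb 2 n) := by
      rw [hγdef]
      field_simp
      ring
    rw [h1]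
    exact le_mul_of_one_le_right (by positivity) ((one_le_div hN0).mpr hNL)
  obtain ⟨S, hS, hSP⟩ := exists_pairwise_disjoint_family
    (fun S : Set (Fin m) => GraphIsExpandingBall (G.induce S) γ ∧
      (m : ℝ) ^ ((1 : ℝ) / 5) ≤ (S.ncard : ℝ) ∧ (S.ncard : ℝ) ≤ (m : ℝ) ^ ((1 : ℝ) / 4))
    X t (b := (m : ℝ) ^ ((1 : ℝ) / 4)) (by positivity) (fun S hS => hS.2.2)
    (fun W hXW hW => exists_expandingBall_avoiding G W hγ (hG.le_ncard_nbhd hδ hL2 hN0)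
      (fun v hv => hXdeg v fun h => hv (hXW h)) ha hab (w := w) (by linarith) (by linarith)
      (by simpa using hV))
  refine ⟨S, hS, fun i => ?_⟩
  obtain ⟨hdisj, hball, hlow, hup⟩ := hSP i
  refine ⟨hball, hlow, hup, fun x => le_trans ?_ (hXdeg x (Set.disjoint_left.mp hdisj x.2))⟩
  rw [← Set.ncard_image_of_injective _ Subtype.val_injective]
  exact_mod_cast Set.ncard_le_ncard (by rintro _ ⟨y, hy, rfl⟩; exact hy) (Set.toFinite _)
end

section
/- There is an absolute constant C > 0 such that for all δ > 0 and every integer t ≥ 3 there exists n₀ = n₀(δ,t) with the following property for all n ≥ n₀: if G is a (δ,n)-expander on m vertices with 2^{log n/(log log n)²} ≤ m ≤ n, and G contains t vertices v_1,…,v_t each of degree at least (log m)⁴, then G contains a K_t-minor of order at most C·(t²/δ)·log n·log log n. -/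
open Real

/-- Vertices reachable from `a` by a walk of length at most `k` that avoids `W`. -/
def avoidingBall {V : Type*} (G : SimpleGraph V) (W : Set V) (a : V) (k : ℕ) : Set V :=
  {u | ∃ p : G.Walk a u, p.length ≤ k ∧ ∀ x ∈ p.support, x ∉ W}

lemma min_le_logb_two_one_add {e : ℝ} (he : 0 ≤ e) : min e 1 ≤ logb 2 (1 + e) := by
  rw [Real.le_logb_iff_rpow_le one_lt_two (by linarith)]
  rcases le_total e 1 with h | h
  · rw [min_eq_left h]
    have := rpow_one_add_le_one_add_mul_self (s := 1) (by norm_num) he h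
    norm_num at this
    exact this
  · rw [min_eq_right h, rpow_one]
    linarith

/-- The integer scale at which the expansion of a set of relative size `2 ^ (-x)` is measured. -/
lemma exists_scale {x M : ℝ} (hx : 1 ≤ x) (hxM : x ≤ M) (hM : 2 ≤ M) :
    ∃ d : ℕ, (d : ℝ) ≤ logb 2 M - 1 ∧ (2 : ℝ) ^ d ≤ x ∧ x ≤ 4 * 2 ^ d := by
  obtain ⟨d, hd, hd'⟩ := exists_nat_pow_near (le_max_left 1 (x / 2)) (one_lt_two (α := ℝ))
  have hdM : (2 : ℝ) ^ d ≤ M / 2 := hd.trans (max_le (by linarith) (by linarith))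
  refine ⟨d, ?_, hd.trans (max_le hx (by linarith)), ?_⟩
  · rw [le_sub_iff_add_le, Real.le_logb_iff_rpow_le one_lt_two (by linarith),
      rpow_add two_pos, rpow_natCast, rpow_one]
    linarith
  · have := le_max_right 1 (x / 2)
    rw [pow_succ] at hd'
    linarith

/-- One expansion step lowers the potential `8 * L / δ * log x + x` by at least one. -/
lemma potential_step {δ L x y : ℝ} (hδ : 0 < δ) (hL : 0 < L) (hx : 1 ≤ x) (hy : 1 ≤ y)
    (h : y ≤ x - min (δ * x / (8 * L)) 1) :
    8 * L / δ * log y + y + 1 ≤ 8 * L / δ * log x + x := by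
  have hc : 0 < 8 * L / δ := by positivity
  have hx0 : 0 < x := by linarith
  have hy0 : 0 < y := by linarith
  have hyx : y ≤ x := by
    have : 0 ≤ min (δ * x / (8 * L)) 1 := le_min (by positivity) zero_le_one
    linarith
  rcases le_total (δ * x / (8 * L)) 1 with he | he
  · rw [min_eq_left he] at h
    have hlog : log y ≤ log x - δ / (8 * L) := by
      have h1 := log_le_sub_one_of_pos (div_pos hy0 hx0)
      rw [log_div hy0.ne' hx0.ne'] at h1
      have h2 : y / x ≤ 1 - δ / (8 * L) := by
        rw [div_le_iff₀ hx0]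
        calc y ≤ x - δ * x / (8 * L) := h
          _ = (1 - δ / (8 * L)) * x := by ring
      linarith
    have h3 := mul_le_mul_of_nonneg_left hlog hc.le
    have h4 : 8 * L / δ * (δ / (8 * L)) = 1 := by field_simp
    rw [mul_sub, h4] at h3
    linarith
  · rw [min_eq_right he] at h
    have := mul_le_mul_of_nonneg_left (log_le_log hy0 hyx) hc.le
    linarith

/-- A sequence growing at the rates prescribed by expansion exceeds `m / 2` after
`O(L / δ * log log m)` steps. -/
lemma half_lt_of_growth {m δ L : ℝ} {b : ℕ → ℝ} (hm : 0 < m) (hδ : 0 < δ) (hL : 0 < L)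
    (hM : 2 ≤ logb 2 m) (hb1 : ∀ k, 1 ≤ b k) (hmono : Monotone b)
    (hb : ∀ k d : ℕ, (d : ℝ) ≤ logb 2 (logb 2 m) - 1 → b k ≤ m / (2 : ℝ) ^ (2 ^ d : ℕ) →
      b k * (1 + δ * 2 ^ d / (2 * L)) ≤ b (k + 1))
    {K : ℕ} (hK : 8 * L / δ * log (logb 2 m) + logb 2 m ≤ K) : m / 2 < b K := by
  have hx1 : ∀ k, b k ≤ m / 2 → 1 ≤ logb 2 (m / b k) := by
    intro k hk
    have h0 : 0 < b k := by linarith [hb1 k]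
    rw [Real.le_logb_iff_rpow_le one_lt_two (by positivity), rpow_one, le_div_iff₀ h0]
    linarith
  have key : ∀ k : ℕ, b k ≤ m / 2 → 8 * L / δ * log (logb 2 (m / b k)) + logb 2 (m / b k) + k ≤
      8 * L / δ * log (logb 2 m) + logb 2 m := by
    intro k
    induction k with
    | zero =>
      intro hk
      have hle : logb 2 (m / b 0) ≤ logb 2 m :=
        logb_le_logb_of_le one_lt_two (div_pos hm (by linarith [hb1 0]))
          (div_le_self hm.le (hb1 0))
      have := mul_le_mul_of_nonneg_left (log_le_log (by linarith [hx1 0 hk]) hle)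
        (show 0 ≤ 8 * L / δ by positivity)
      simp only [Nat.cast_zero]
      linarith
    | succ k ih =>
      intro hk'
      have hk : b k ≤ m / 2 := (hmono k.le_succ).trans hk'
      have h0 : 0 < b k := by linarith [hb1 k]
      have h0' : 0 < b (k + 1) := by linarith [hb1 (k + 1)]
      have hx := hx1 k hk
      have hxM : logb 2 (m / b k) ≤ logb 2 m :=
        logb_le_logb_of_le one_lt_two (div_pos hm h0) (div_le_self hm.le (hb1 k))
      obtain ⟨d, hdM, hdx, hxd⟩ := exists_scale hx hxM hM
      have hsize : b k ≤ m / (2 : ℝ) ^ (2 ^ d : ℕ) := by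
        rw [le_div_iff₀ (by positivity), mul_comm, ← le_div_iff₀ h0, ← rpow_natCast,
          ← Real.le_logb_iff_rpow_le one_lt_two (by positivity)]
        exact_mod_cast hdx
      have hgrow := hb k d hdM hsize
      set x := logb 2 (m / b k) with hxdef
      set e := δ * x / (8 * L) with hedef
      have he0 : 0 ≤ e := by positivity
      have hed : e ≤ δ * 2 ^ d / (2 * L) := by
        rw [hedef, div_le_div_iff₀ (by positivity) (by positivity)]
        have : δ * L * x ≤ δ * L * (4 * 2 ^ d) := by gcongr
        nlinarith
      have hgrow' : b k * (1 + e) ≤ b (k + 1) := le_trans (by gcongr) hgrow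
      have hlogs : logb 2 (b k) + logb 2 (1 + e) ≤ logb 2 (b (k + 1)) := by
        rw [← logb_mul h0.ne' (by positivity)]
        exact logb_le_logb_of_le one_lt_two (by positivity) hgrow'
      have hstep : logb 2 (m / b (k + 1)) ≤ x - min e 1 := by
        have := min_le_logb_two_one_add he0
        rw [hxdef, logb_div hm.ne' h0.ne', logb_div hm.ne' h0'.ne']
        linarith
      have := potential_step hδ hL hx (hx1 (k + 1) hk') hstep
      push_cast
      linarith [ih hk]
  by_contra! hcon
  have h1 := key K hcon
  have h2 := hx1 K hcon
  have h3 : 0 ≤ 8 * L / δ * log (logb 2 (m / b K)) :=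
    mul_nonneg (by positivity) (log_nonneg h2)
  linarith

section

variable {V : Type*} {G : SimpleGraph V} {W : Set V} {a b : V} {k : ℕ}

lemma avoidingBall_mono : Monotone (avoidingBall G W a) :=
  fun _ _ hkl _ ⟨p, hp, hW⟩ => ⟨p, hp.trans hkl, hW⟩

lemma mem_avoidingBall_self (ha : a ∉ W) : a ∈ avoidingBall G W a k :=
  ⟨.nil, by simp, by simpa using ha⟩

lemma nbhd_avoidingBall_diff_subset :
    nbhd G (avoidingBall G W a k) \ W ⊆ avoidingBall G W a (k + 1) := by
  rintro x ⟨⟨-, u, ⟨p, hp, hW⟩, hadj⟩, hx⟩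
  refine ⟨p.concat hadj, by simpa using hp, fun y hy => ?_⟩
  rw [SimpleGraph.Walk.support_concat, List.mem_append] at hy
  rcases hy with hy | hy
  · exact hW y hy
  · rw [List.mem_singleton.mp hy]
    exact hx

lemma neighborSet_diff_subset_avoidingBall (ha : a ∉ W) :
    G.neighborSet a \ W ⊆ avoidingBall G W a (k + 1) := by
  rintro x ⟨hx, hxW⟩
  have hadj : G.Adj a x := hx
  refine ⟨.cons hadj .nil, by simp, ?_⟩
  simp [ha, hxW]

lemma ncard_avoidingBall_succ [Finite V] :
    (avoidingBall G W a k).ncard + (nbhd G (avoidingBall G W a k)).ncard ≤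
      (avoidingBall G W a (k + 1)).ncard + W.ncard := by
  have hdisj : Disjoint (avoidingBall G W a k) (nbhd G (avoidingBall G W a k)) :=
    Set.disjoint_right.mpr fun _ hx => hx.1
  rw [← Set.ncard_union_eq hdisj]
  refine (Set.ncard_le_ncard ?_).trans (Set.ncard_union_le _ _)
  rintro x (hx | hx)
  · exact Or.inl (avoidingBall_mono k.le_succ hx)
  · by_cases hxW : x ∈ W
    · exact Or.inr hxW
    · exact Or.inl (nbhd_avoidingBall_diff_subset ⟨hx, hxW⟩)

/-- Removing the endpoint from a walk leaves a connected set adjacent to the endpoint. -/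
lemma SimpleGraph.Walk.exists_connected_adj_end (p : G.Walk a b) (hab : a ≠ b) :
    ∃ Q : Set V, a ∈ Q ∧ b ∉ Q ∧ (∀ x ∈ Q, x ∈ p.support) ∧ (G.induce Q).Connected ∧
      (∃ u ∈ Q, G.Adj u b) ∧ Q.ncard ≤ p.length := by
  induction p with
  | nil => exact absurd rfl hab
  | @cons a c b h p ih =>
    by_cases hcb : c = b
    · subst hcb
      refine ⟨{a}, rfl, fun h => hab h.symm, by simp, ?_, ⟨a, rfl, h⟩, by simp⟩
      exact { preconnected := SimpleGraph.Preconnected.of_subsingleton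
              nonempty := ⟨⟨a, rfl⟩⟩ }
    · obtain ⟨Q, hcQ, hbQ, hQp, hQ, ⟨u, huQ, hu⟩, hcard⟩ := ih hcb
      refine ⟨insert a Q, Set.mem_insert _ _, ?_, ?_, ?_, ⟨u, Set.mem_insert_of_mem _ huQ, hu⟩, ?_⟩
      · rintro (h | h)
        · exact hab h.symm
        · exact hbQ h
      · rintro x (rfl | hx)
        · simp
        · simp [hQp x hx]
      · have := SimpleGraph.induce_union_connected
          (SimpleGraph.induce_pair_connected_of_adj h).preconnected hQ.preconnected
          ⟨c, by simp, hcQ⟩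
        rwa [Set.insert_union, Set.singleton_union, Set.insert_eq_of_mem hcQ] at this
      · rw [SimpleGraph.Walk.length_cons]
        exact (Set.ncard_insert_le _ _).trans (by omega)

end

lemma half_lt_ncard_avoidingBall {V : Type*} [Finite V] {G : SimpleGraph V} {W : Set V} {a : V}
    {δ D : ℝ} {n K : ℕ} (hG : IsDeltaNExpander G δ n) (hδ : 0 < δ) (hL : 0 < logb 2 n)
    (hM : 2 ≤ logb 2 (Nat.card V)) (ha : a ∉ W) (hdeg : D ≤ (G.neighborSet a).ncard)
    (hW : (W.ncard : ℝ) ≤ D / 2) (hWexp : (W.ncard : ℝ) ≤ δ / (2 * logb 2 n) * (D / 2))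
    (hK : 8 * logb 2 n / δ * log (logb 2 (Nat.card V)) + logb 2 (Nat.card V) ≤ K) :
    (Nat.card V : ℝ) / 2 < (avoidingBall G W a (K + 1)).ncard := by
  have : Nonempty V := ⟨a⟩
  refine half_lt_of_growth (b := fun k => ((avoidingBall G W a (k + 1)).ncard : ℝ))
    (by exact_mod_cast Nat.card_pos) hδ hL hM ?_ ?_ ?_ hK
  · intro k
    have : 0 < (avoidingBall G W a (k + 1)).ncard :=
      (Set.ncard_pos).mpr ⟨a, mem_avoidingBall_self ha⟩
    exact_mod_cast this
  · intro k l hkl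
    exact Nat.cast_le.mpr (Set.ncard_le_ncard (avoidingBall_mono (Nat.succ_le_succ hkl)))
  · intro k d hd hsize
    have hexp := hG d hd _ hsize
    have hsucc : ((avoidingBall G W a (k + 1)).ncard : ℝ) +
        (nbhd G (avoidingBall G W a (k + 1))).ncard ≤
        (avoidingBall G W a (k + 1 + 1)).ncard + W.ncard := by
      exact_mod_cast ncard_avoidingBall_succ (G := G) (W := W) (a := a) (k := k + 1)
    have hlarge : D / 2 ≤ (avoidingBall G W a (k + 1)).ncard := by
      have h1 : ((G.neighborSet a).ncard : ℝ) ≤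
          (avoidingBall G W a (k + 1)).ncard + W.ncard := by
        have : (G.neighborSet a).ncard ≤ (avoidingBall G W a (k + 1)).ncard + W.ncard := by
          refine (Set.ncard_le_ncard fun x hx => ?_).trans (Set.ncard_union_le _ _)
          by_cases hxW : x ∈ W
          · exact Or.inr hxW
          · exact Or.inl (neighborSet_diff_subset_avoidingBall ha ⟨hx, hxW⟩)
        exact_mod_cast this
      linarith
    set B : ℝ := ((avoidingBall G W a (k + 1)).ncard : ℝ)
    have hWB : (W.ncard : ℝ) ≤ δ * 2 ^ d / (2 * logb 2 n) * B := by
      refine hWexp.trans ?_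
      have h2 : (1 : ℝ) ≤ 2 ^ d := one_le_pow₀ one_le_two
      have hB : 0 ≤ B := Nat.cast_nonneg _
      calc δ / (2 * logb 2 n) * (D / 2) ≤ δ / (2 * logb 2 n) * B := by gcongr
        _ ≤ δ * 2 ^ d / (2 * logb 2 n) * B := by
          gcongr
          exact le_mul_of_one_le_right hδ.le h2
    have hsplit : δ * 2 ^ d / logb 2 n * B = 2 * (δ * 2 ^ d / (2 * logb 2 n) * B) := by
      field_simp
    change B * (1 + δ * 2 ^ d / (2 * logb 2 n)) ≤ _
    linarith

/-- Two vertices of large degree in an expander are joined by a short connected set that avoids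
a given small set of vertices. -/
lemma exists_short_connector {V : Type*} [Finite V] {G : SimpleGraph V} {W : Set V} {a b : V}
    {δ D : ℝ} {n K : ℕ} (hG : IsDeltaNExpander G δ n) (hδ : 0 < δ) (hL : 0 < logb 2 n)
    (hM : 2 ≤ logb 2 (Nat.card V)) (hab : a ≠ b) (ha : a ∉ W) (hb : b ∉ W)
    (hdega : D ≤ (G.neighborSet a).ncard) (hdegb : D ≤ (G.neighborSet b).ncard)
    (hW : (W.ncard : ℝ) ≤ D / 2) (hWexp : (W.ncard : ℝ) ≤ δ / (2 * logb 2 n) * (D / 2))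
    (hK : 8 * logb 2 n / δ * log (logb 2 (Nat.card V)) + logb 2 (Nat.card V) ≤ K) :
    ∃ Q : Set V, a ∈ Q ∧ b ∉ Q ∧ Disjoint Q W ∧ (G.induce Q).Connected ∧
      (∃ u ∈ Q, G.Adj u b) ∧ Q.ncard ≤ 2 * (K + 1) := by
  have hBa := half_lt_ncard_avoidingBall hG hδ hL hM ha hdega hW hWexp hK
  have hBb := half_lt_ncard_avoidingBall hG hδ hL hM hb hdegb hW hWexp hK
  have hmeet : (avoidingBall G W a (K + 1) ∩ avoidingBall G W b (K + 1)).Nonempty := by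
    rw [← Set.not_disjoint_iff_nonempty_inter]
    intro hdisj
    have h1 := Set.ncard_union_eq hdisj
    have h2 := Set.ncard_le_card (avoidingBall G W a (K + 1) ∪ avoidingBall G W b (K + 1))
    rw [h1] at h2
    have h3 : ((avoidingBall G W a (K + 1)).ncard : ℝ) + (avoidingBall G W b (K + 1)).ncard ≤
      Nat.card V := by exact_mod_cast h2
    linarith
  obtain ⟨x, ⟨p, hp, hpW⟩, ⟨q, hq, hqW⟩⟩ := hmeet
  obtain ⟨Q, haQ, hbQ, hQs, hQ, hadj, hcard⟩ :=
    (p.append q.reverse).exists_connected_adj_end hab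
  refine ⟨Q, haQ, hbQ, Set.disjoint_left.mpr fun y hy => ?_, hQ, hadj, hcard.trans ?_⟩
  · have := hQs y hy
    rw [SimpleGraph.Walk.mem_support_append_iff, SimpleGraph.Walk.support_reverse,
      List.mem_reverse] at this
    exact this.elim (hpW y) (hqW y)
  · rw [SimpleGraph.Walk.length_append, SimpleGraph.Walk.length_reverse]
    omega

/-- If roots can always be joined by connectors of size at most `k` avoiding any set of size at
most `t + t ^ 2 * k`, then they are the centres of a small complete minor. -/
lemma hasKtMinorOfOrder_of_connectors {V : Type*} [Finite V] {G : SimpleGraph V} {t k : ℕ}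
    {v : Fin t → V} (hv : Function.Injective v)
    (hconn : ∀ i j, i ≠ j → ∀ W : Set V, v i ∉ W → v j ∉ W → W.ncard ≤ t + t ^ 2 * k →
      ∃ Q : Set V, v i ∈ Q ∧ v j ∉ Q ∧ Disjoint Q W ∧ (G.induce Q).Connected ∧
        (∃ u ∈ Q, G.Adj u (v j)) ∧ Q.ncard ≤ k) :
    HasKtMinorOfOrder G t ((t + t ^ 2 * k : ℕ) : ℝ) := by
  classical
  have hcard : ∀ s : Finset (Fin t × Fin t), s.card ≤ t ^ 2 := fun s =>
    (Finset.card_le_univ s).trans (by simp [sq])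
  have key : ∀ s : Finset (Fin t × Fin t), ∃ P : Fin t → Set V,
      (∀ i, v i ∈ P i) ∧ Pairwise (Function.onFun Disjoint P) ∧
      (∀ i, (G.induce (P i)).Connected) ∧
      (∀ e ∈ s, e.1 < e.2 → ∃ u ∈ P e.1, ∃ w ∈ P e.2, G.Adj u w) ∧
      (⋃ i, P i).ncard ≤ t + s.card * k := by
    intro s
    induction s using Finset.induction_on with
    | empty =>
      refine ⟨fun i => {v i}, fun i => rfl, fun i j hij => ?_, fun i => ?_, by simp, ?_⟩
      · simpa [Function.onFun] using hv.ne hij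
      · exact { preconnected := SimpleGraph.Preconnected.of_subsingleton
                nonempty := ⟨⟨v i, rfl⟩⟩ }
      · have : (⋃ i, ({v i} : Set V)) = Set.range v := by
          ext x
          simp [eq_comm]
        rw [this, ← Set.image_univ]
        refine (Set.ncard_image_le).trans ?_
        simp
    | insert e s hes ih =>
      obtain ⟨P, hvP, hdisj, hPconn, hadj, hPcard⟩ := ih
      by_cases hlt : e.1 < e.2
      swap
      · refine ⟨P, hvP, hdisj, hPconn, fun f hf hfl => ?_, ?_⟩
        · rcases Finset.mem_insert.mp hf with rfl | hf
          · exact absurd hfl hlt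
          · exact hadj f hf hfl
        · rw [Finset.card_insert_of_notMem hes, add_mul]
          omega
      set W : Set V := (⋃ i, P i) \ {v e.1, v e.2} with hWdef
      have hWcard : W.ncard ≤ t + t ^ 2 * k := by
        refine (Set.ncard_le_ncard Set.sdiff_subset).trans (hPcard.trans ?_)
        gcongr
        exact hcard s
      obtain ⟨Q, hiQ, hjQ, hQW, hQconn, ⟨u, huQ, hu⟩, hQcard⟩ :=
        hconn e.1 e.2 hlt.ne W (by simp [hWdef]) (by simp [hWdef]) hWcard
      have hQP : ∀ l, l ≠ e.1 → Disjoint Q (P l) := by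
        intro l hl
        refine Set.disjoint_left.mpr fun x hxQ hxP => ?_
        refine Set.disjoint_left.mp hQW hxQ ⟨Set.mem_iUnion.mpr ⟨l, hxP⟩, ?_⟩
        rintro (rfl | rfl)
        · exact Set.disjoint_left.mp (hdisj hl) hxP (hvP e.1)
        · exact hjQ hxQ
      have hsub : ∀ l, P l ⊆ Function.update P e.1 (P e.1 ∪ Q) l := by
        intro l
        by_cases hl : l = e.1
        · subst hl
          simp
        · simp [hl]
      refine ⟨Function.update P e.1 (P e.1 ∪ Q), fun l => hsub l (hvP l), ?_, ?_, ?_, ?_⟩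
      · intro l l' hll
        simp only [Function.onFun]
        by_cases hl : l = e.1
        · have hl' : l' ≠ e.1 := fun h => hll (hl.trans h.symm)
          subst hl
          simpa [hl'] using ⟨hdisj hll, hQP l' hl'⟩
        · by_cases hl' : l' = e.1
          · subst hl'
            simpa [hl] using ⟨hdisj hll, (hQP l hl).symm⟩
          · simpa [hl, hl'] using hdisj hll
      · intro l
        by_cases hl : l = e.1
        · subst hl
          rw [Function.update_self]
          exact SimpleGraph.induce_union_connected (hPconn _).preconnected hQconn.preconnected
            ⟨_, hvP _, hiQ⟩
        · rw [Function.update_of_ne hl]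
          exact hPconn l
      · intro f hf hfl
        rcases Finset.mem_insert.mp hf with rfl | hf
        · exact ⟨u, by simp [huQ], v f.2, hsub _ (hvP _), hu⟩
        · obtain ⟨x, hx, y, hy, hxy⟩ := hadj f hf hfl
          exact ⟨x, hsub _ hx, y, hsub _ hy, hxy⟩
      · have hU : (⋃ l, Function.update P e.1 (P e.1 ∪ Q) l) ⊆ (⋃ l, P l) ∪ Q := by
          refine Set.iUnion_subset fun l => ?_
          by_cases hl : l = e.1
          · subst hl
            rw [Function.update_self]
            exact Set.union_subset_union_left _ (Set.subset_iUnion P _)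
          · rw [Function.update_of_ne hl]
            exact (Set.subset_iUnion P l).trans Set.subset_union_left
        refine (Set.ncard_le_ncard hU).trans ((Set.ncard_union_le _ _).trans ?_)
        rw [Finset.card_insert_of_notMem hes, add_mul]
        omega
  obtain ⟨P, hvP, hdisj, hPconn, hadj, hPcard⟩ := key Finset.univ
  refine ⟨P, fun i => ⟨v i, hvP i⟩, hdisj, hPconn,
    fun i j hij => hadj (i, j) (Finset.mem_univ _) hij, ?_⟩
  have : (⋃ i, P i).ncard ≤ t + t ^ 2 * k :=
    hPcard.trans (by gcongr; exact hcard _)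
  exact_mod_cast this

/-- Any power of `log log n` is eventually smaller than any multiple of `log n`. -/
lemma eventually_logb_logb_pow_le (r : ℕ) {c : ℝ} (hc : 0 < c) :
    ∀ᶠ n : ℕ in Filter.atTop, logb 2 (logb 2 n) ^ r ≤ c * logb 2 n := by
  have hL : Filter.Tendsto (fun n : ℕ => logb 2 (n : ℝ)) Filter.atTop Filter.atTop :=
    (tendsto_logb_atTop one_lt_two).comp tendsto_natCast_atTop_atTop
  have h := (isLittleO_pow_logb_id_atTop (b := 2) (n := r)).bound hc
  filter_upwards [hL.eventually h, hL.eventually_ge_atTop 0] with n hn hn0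
  simp only [norm_eq_abs, id, abs_of_nonneg hn0] at hn
  exact (le_abs_self _).trans hn

/-- Claim 4.6: for large `n`, a `(δ,n)`-expander on `m` vertices with
`2^{log n/(log log n)²} ≤ m ≤ n` having `t` vertices of degree at least `(log m)⁴`
has a `K_t`-minor of order `O((t²/δ)·log n·log log n)`. -/
theorem stmt_13 :
    ∃ C : ℝ, 0 < C ∧
      ∀ δ : ℝ, 0 < δ → ∀ t : ℕ, 3 ≤ t → ∃ n₀ : ℕ,
        ∀ n : ℕ, n₀ ≤ n → ∀ m : ℕ,
          (2 : ℝ) ^ (logb 2 n / (logb 2 (logb 2 n)) ^ 2) ≤ (m : ℝ) → m ≤ n →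
            ∀ G : SimpleGraph (Fin m), IsDeltaNExpander G δ n →
              ∀ v : Fin t → Fin m, Function.Injective v →
                (∀ i, ((G.neighborSet (v i)).ncard : ℝ) ≥ (logb 2 m) ^ 4) →
                  HasKtMinorOfOrder G t
                    (C * (t ^ 2 / δ) * logb 2 n * logb 2 (logb 2 n)) := by
  refine ⟨30, by norm_num, fun δ hδ t ht => ?_⟩
  have hL : Filter.Tendsto (fun n : ℕ => logb 2 (n : ℝ)) Filter.atTop Filter.atTop :=
    (tendsto_logb_atTop one_lt_two).comp tendsto_natCast_atTop_atTop
  have hl : Filter.Tendsto (fun n : ℕ => logb 2 (logb 2 (n : ℝ))) Filter.atTop Filter.atTop :=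
    (tendsto_logb_atTop one_lt_two).comp hL
  have ht0 : (3 : ℝ) ≤ t := by exact_mod_cast ht
  have hev := (hL.eventually_ge_atTop 1).and <| (hL.eventually_ge_atTop δ).and <|
    (hl.eventually_ge_atTop 1).and <| (hl.eventually_ge_atTop δ).and <|
    (eventually_logb_logb_pow_le 2 (c := 1 / 2) (by norm_num)).and <|
    (eventually_logb_logb_pow_le 9 (c := δ / (60 * t ^ 2)) (by positivity)).and
    (eventually_logb_logb_pow_le 9 (c := δ ^ 2 / (120 * t ^ 2)) (by positivity))
  obtain ⟨n₀, hn₀⟩ := Filter.eventually_atTop.mp hev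
  refine ⟨n₀, fun n hn m hm hmn G hG v hv hdeg => ?_⟩
  obtain ⟨hL1, hLδ, hl1, hlδ, hl2, hl9, hl9'⟩ := hn₀ n hn
  have hm0 : (0 : ℝ) < m := lt_of_lt_of_le (by positivity) hm
  have hML : logb 2 (m : ℝ) ≤ logb 2 n :=
    logb_le_logb_of_le one_lt_two hm0 (by exact_mod_cast hmn)
  have hMlow : logb 2 (n : ℝ) / (logb 2 (logb 2 n)) ^ 2 ≤ logb 2 m :=
    (Real.le_logb_iff_rpow_le one_lt_two hm0).mpr hm
  set L := logb 2 (n : ℝ) with hLdef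
  set l := logb 2 L with hldef
  set M := logb 2 (m : ℝ) with hMdef
  have hL0 : 0 < L := by linarith
  have hl0 : 0 < l := by linarith
  have hM2 : 2 ≤ M := by
    refine le_trans ?_ hMlow
    rw [le_div_iff₀ (by positivity)]
    linarith
  set X := L * l / δ with hXdef
  have hX1 : 1 ≤ X := by
    rw [hXdef, le_div_iff₀ hδ]
    nlinarith
  have hLX : L ≤ X := by
    rw [hXdef, le_div_iff₀ hδ]
    exact mul_le_mul_of_nonneg_left hlδ hL0.le
  have hM4 : L ^ 4 / l ^ 8 ≤ M ^ 4 := by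
    calc L ^ 4 / l ^ 8 = (L / l ^ 2) ^ 4 := by rw [div_pow]; ring
      _ ≤ M ^ 4 := by gcongr
  have hA : 30 * t ^ 2 * X ≤ M ^ 4 / 2 := by
    have h1 : 60 * t ^ 2 * X ≤ L ^ 4 / l ^ 8 := by
      rw [hXdef, le_div_iff₀ (by positivity)]
      have h2 : 60 * t ^ 2 / δ * l ^ 9 ≤ L := by
        calc 60 * t ^ 2 / δ * l ^ 9 ≤ 60 * t ^ 2 / δ * (δ / (60 * t ^ 2) * L) := by gcongr
          _ = L := by field_simp
      calc 60 * t ^ 2 * (L * l / δ) * l ^ 8 = L * (60 * t ^ 2 / δ * l ^ 9) := by ring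
        _ ≤ L * L := by gcongr
        _ = L ^ 2 := by ring
        _ ≤ L ^ 4 := pow_le_pow_right₀ hL1 (by norm_num)
    linarith
  have hA' : 30 * t ^ 2 * X ≤ δ / (2 * L) * (M ^ 4 / 2) := by
    have h1 : 120 * t ^ 2 * X * L / δ ≤ L ^ 4 / l ^ 8 := by
      rw [hXdef, le_div_iff₀ (by positivity)]
      have h2 : 120 * t ^ 2 / δ ^ 2 * l ^ 9 ≤ L := by
        calc 120 * t ^ 2 / δ ^ 2 * l ^ 9
            ≤ 120 * t ^ 2 / δ ^ 2 * (δ ^ 2 / (120 * t ^ 2) * L) := by gcongr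
          _ = L := by field_simp
      calc 120 * t ^ 2 * (L * l / δ) * L / δ * l ^ 8
          = L ^ 2 * (120 * t ^ 2 / δ ^ 2 * l ^ 9) := by field_simp
        _ ≤ L ^ 2 * L := by gcongr
        _ = L ^ 3 := by ring
        _ ≤ L ^ 4 := pow_le_pow_right₀ hL1 (by norm_num)
    calc 30 * t ^ 2 * X = δ / (4 * L) * (120 * t ^ 2 * X * L / δ) := by field_simp; norm_num
      _ ≤ δ / (4 * L) * M ^ 4 := by gcongr; exact h1.trans hM4
      _ = δ / (2 * L) * (M ^ 4 / 2) := by field_simp; norm_num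
  obtain ⟨K, hK, hKX⟩ : ∃ K : ℕ, 8 * L / δ * log M + M ≤ K ∧ (K : ℝ) ≤ 10 * X := by
    have hlogM : log M ≤ l := by
      have h1 : log M ≤ log L := log_le_log (by linarith) hML
      have h2 : log L ≤ l := by
        rw [hldef, logb, le_div_iff₀ (log_pos one_lt_two)]
        have := log_two_lt_d9
        exact mul_le_of_le_one_right (log_nonneg hL1) (by linarith)
      exact h1.trans h2
    have hlogM0 : 0 ≤ log M := log_nonneg (by linarith)
    refine ⟨⌈8 * L / δ * log M + M⌉₊, Nat.le_ceil _, ?_⟩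
    have h1 := (Nat.ceil_lt_add_one
      (show 0 ≤ 8 * L / δ * log M + M by positivity)).le
    have h2 : 8 * L / δ * log M ≤ 8 * X := by
      calc 8 * L / δ * log M ≤ 8 * L / δ * l := by gcongr
        _ = 8 * X := by rw [hXdef]; ring
    linarith
  have horder : ((t + t ^ 2 * (2 * (K + 1)) : ℕ) : ℝ) ≤ 30 * t ^ 2 * X := by
    push_cast
    have h1 : (t : ℝ) ≤ t ^ 2 * X := by nlinarith
    have h2 : (t : ℝ) ^ 2 * (2 * (K + 1)) ≤ t ^ 2 * (22 * X) := by
      refine mul_le_mul_of_nonneg_left ?_ (by positivity)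
      linarith
    have h3 : 0 ≤ (t : ℝ) ^ 2 * X := by positivity
    linarith
  have hminor := hasKtMinorOfOrder_of_connectors (k := 2 * (K + 1)) hv
    fun i j hij W hi hj hW => by
      have hW' : (W.ncard : ℝ) ≤ 30 * t ^ 2 * X := le_trans (by exact_mod_cast hW) horder
      refine exists_short_connector hG hδ hL0 ?_ (hv.ne hij) hi hj (hdeg i) (hdeg j)
        (hW'.trans hA) (hW'.trans hA') ?_
      · rwa [Nat.card_fin]
      · rwa [Nat.card_fin]
  obtain ⟨P, h1, h2, h3, h4, h5⟩ := hminor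
  refine ⟨P, h1, h2, h3, h4, h5.trans (horder.trans (le_of_eq ?_))⟩
  rw [hXdef]
  ring
end

section
/- There is an absolute constant C > 0 such that for all δ > 0 and every integer t ≥ 3 there exists n₀ = n₀(δ,t) with the following property for all n ≥ n₀: let G be a (δ,n)-expander on m vertices with 2^{log n/(log log n)²} ≤ m ≤ n and set γ = δ·log m/(5·log n); if G contains t pairwise disjoint vertex sets S_1,…,S_t such that each induced subgraph G[S_i] is a γ-expanding ball, m^{1/5} ≤ |S_i| ≤ m^{1/4}, and every vertex of G[S_i] has degree at most (log m)⁴ in G[S_i], then G contains a K_t-minor of order at most C·(t²/δ)·log n·log log n. -/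
open Real

/-- Splitting a walk that ends in `Y'`: its last stretch before `Y'` either contains the start
and avoids `Y`, or leaves `Y` exactly at its own starting point. -/
theorem exists_connected_segment {V : Type*} (G : SimpleGraph V) (Y Y' : Set V) {a b : V}
    (p : G.Walk a b) (ha : a ∉ Y') (hb : b ∈ Y') :
    ∃ I : Set V, I ⊆ {x | x ∈ p.support} ∧ (G.induce I).Connected ∧ Disjoint I Y' ∧
      (∃ x ∈ I, ∃ w ∈ Y', G.Adj x w) ∧
      ((∃ u ∈ Y, I ∩ Y = {u}) ∨ (a ∈ I ∧ Disjoint I Y)) := by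
  induction p with
  | nil => exact absurd hb ha
  | @cons a c b h p ih =>
    by_cases hc : c ∈ Y'
    · refine ⟨{a}, ?_, ?_, ?_, ⟨a, rfl, c, hc, h⟩, ?_⟩
      · simp
      · exact SimpleGraph.Connected.of_subsingleton
      · simpa using ha
      · by_cases haY : a ∈ Y
        · exact Or.inl ⟨a, haY, by ext x; simp; rintro rfl; exact haY⟩
        · exact Or.inr ⟨rfl, by simpa using haY⟩
    · obtain ⟨I, hI, hcon, hdis, hadj, hor⟩ := ih hc hb
      rcases hor with hu | ⟨hcI, hIY⟩
      · exact ⟨I, fun x hx => by simpa using Or.inr (hI hx), hcon, hdis, hadj, Or.inl hu⟩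
      · obtain ⟨x, hx, w, hw, hxw⟩ := hadj
        refine ⟨{a} ∪ I, ?_, ?_, ?_, ⟨x, Or.inr hx, w, hw, hxw⟩, ?_⟩
        · rintro y (rfl | hy)
          · simp
          · simpa using Or.inr (hI hy)
        · exact SimpleGraph.connected_induce_union (SimpleGraph.Preconnected.of_subsingleton)
            hcon.preconnected rfl hcI h
        · exact Disjoint.union_left (by simpa using ha) hdis
        · by_cases haY : a ∈ Y
          · refine Or.inl ⟨a, haY, ?_⟩
            rw [Set.union_inter_distrib_right, hIY.inter_eq, Set.union_empty]
            ext x; simp; rintro rfl; exact haY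
          · exact Or.inr ⟨Or.inl rfl, Disjoint.union_left (by simpa using haY) hIY⟩

theorem ncard_support_le {V : Type*} {G : SimpleGraph V} {a b : V} (p : G.Walk a b) :
    {x | x ∈ p.support}.ncard ≤ p.length + 1 := by
  classical
  rw [← p.length_support, ← List.coe_toFinset, Set.ncard_coe_finset]
  exact p.support.toFinset_card_le

/-- A connected set `X` through `c` can be joined to any vertex of a set `B` of radius `R`
around `c` by adding at most `R + 1` vertices of `B`. -/
theorem exists_connected_attach {V : Type*} (G : SimpleGraph V) (X B : Set V) (c : V) (R : ℕ)
    (hX : (G.induce X).Connected) (hc : c ∈ X)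
    (hB : ∀ u ∈ B, ∃ p : G.Walk c u, p.length ≤ R ∧ ∀ x ∈ p.support, x ∈ B)
    {u : V} (hu : u ∈ X ∪ B) :
    ∃ W ⊆ B, u ∈ X ∪ W ∧ (G.induce (X ∪ W)).Connected ∧ W.ncard ≤ R + 1 := by
  rcases hu with hu | hu
  · exact ⟨∅, by simp, by simpa using hu, by rwa [Set.union_empty], by simp⟩
  · obtain ⟨p, hp, hpB⟩ := hB u hu
    exact ⟨{x | x ∈ p.support}, hpB, Or.inr (by simp),
      SimpleGraph.induce_union_connected hX.preconnected
        p.connected_induce_support.preconnected ⟨c, hc, by simp⟩,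
      (ncard_support_le p).trans (by omega)⟩

/-- Disjoint branch sets `X`, kept apart from the cores `B` of the other branches, can be enlarged
along a walk from core `i` to core `j` so that the branches `i` and `j` become adjacent. -/
theorem exists_branch_extension {V ι : Type*} [Finite V] (G : SimpleGraph V)
    (X B : ι → Set V) (c : ι → V) (R T : ℕ)
    (hXc : ∀ i, (G.induce (X i)).Connected) (hc : ∀ i, c i ∈ X i)
    (hXX : ∀ i j, i ≠ j → Disjoint (X i) (X j))
    (hXB : ∀ i j, i ≠ j → Disjoint (X i) (B j))
    (hBB : ∀ i j, i ≠ j → Disjoint (B i) (B j))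
    (hB : ∀ i, ∀ u ∈ B i, ∃ p : G.Walk (c i) u, p.length ≤ R ∧ ∀ x ∈ p.support, x ∈ B i)
    {i j : ι} (hij : i ≠ j) (p : G.Walk (c i) (c j)) (hp : p.length ≤ T)
    (hpl : ∀ x ∈ p.support, ∀ l, l ≠ i → l ≠ j → x ∉ X l ∪ B l) :
    ∃ X' : ι → Set V, (∀ l, X l ⊆ X' l) ∧ (∀ l, (G.induce (X' l)).Connected) ∧
      (∀ a b, a ≠ b → Disjoint (X' a) (X' b)) ∧ (∀ a b, a ≠ b → Disjoint (X' a) (B b)) ∧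
      (∃ x ∈ X' i, ∃ y ∈ X' j, G.Adj x y) ∧
      (⋃ l, X' l).ncard ≤ (⋃ l, X l).ncard + (T + 1 + 2 * (R + 1)) := by
  classical
  have hYY : ∀ a b, a ≠ b → Disjoint (X a ∪ B a) (X b ∪ B b) := fun a b hab =>
    Disjoint.union_left (Disjoint.union_right (hXX a b hab) (hXB a b hab))
      (Disjoint.union_right (hXB b a hab.symm).symm (hBB a b hab))
  obtain ⟨I, hIs, hIc, hIj, ⟨x, hxI, w, hw, hxw⟩, hor⟩ :=
    exists_connected_segment G (X i ∪ B i) (X j ∪ B j) p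
      (Set.disjoint_left.1 (hYY i j hij) (Or.inl (hc i))) (Or.inl (hc j))
  obtain ⟨u, hu, huI⟩ : ∃ u ∈ X i ∪ B i, u ∈ I := by
    rcases hor with ⟨u, hu, h⟩ | ⟨h, -⟩
    · exact ⟨u, hu, ((Set.ext_iff.1 h u).2 rfl).1⟩
    · exact ⟨c i, Or.inl (hc i), h⟩
  have hIl : ∀ l, l ≠ i → Disjoint I (X l ∪ B l) := by
    intro l hl
    by_cases hlj : l = j
    · exact hlj ▸ hIj
    · exact Set.disjoint_left.2 fun y hy => hpl y (hIs hy) l hl hlj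
  obtain ⟨Wi, hWi, hui, hci, hni⟩ :=
    exists_connected_attach G (X i) (B i) (c i) R (hXc i) (hc i) (hB i) hu
  obtain ⟨Wj, hWj, hwj, hcj, hnj⟩ :=
    exists_connected_attach G (X j) (B j) (c j) R (hXc j) (hc j) (hB j) hw
  have hsub : ∀ l, (if l = i then X i ∪ Wi ∪ I else if l = j then X j ∪ Wj else X l) ⊆
      (X l ∪ B l) ∪ (if l = i then I else ∅) := by
    intro l
    split_ifs with h1 h2
    · subst h1
      exact Set.union_subset_union_left _ (Set.union_subset_union_right _ hWi)
    · subst h2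
      exact Set.subset_union_of_subset_left (Set.union_subset_union_right _ hWj) _
    · exact fun y hy => Or.inl (Or.inl hy)
  have hYI : ∀ a b, a ≠ b → Disjoint ((X a ∪ B a) ∪ (if a = i then I else ∅)) (X b ∪ B b) := by
    intro a b hab
    refine Disjoint.union_left (hYY a b hab) ?_
    split_ifs with h
    · exact hIl b (by rintro rfl; exact hab h)
    · simp
  refine ⟨fun l => if l = i then X i ∪ Wi ∪ I else if l = j then X j ∪ Wj else X l,
    ?_, ?_, ?_, ?_, ?_, ?_⟩
  · intro l
    dsimp only
    split_ifs with h1 h2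
    · subst h1; exact fun y hy => Or.inl (Or.inl hy)
    · subst h2; exact fun y hy => Or.inl hy
    · exact subset_rfl
  · intro l
    dsimp only
    by_cases h1 : l = i
    · rw [if_pos h1]
      exact SimpleGraph.induce_union_connected hci.preconnected hIc.preconnected ⟨u, hui, huI⟩
    · rw [if_neg h1]
      by_cases h2 : l = j
      · rwa [if_pos h2]
      · rw [if_neg h2]
        exact hXc l
  · intro a b hab
    by_cases hb : b = i
    · have ha : a ≠ i := fun h => hab (h.trans hb.symm)
      refine Disjoint.symm ((hYI b a hab.symm).mono (hsub b) ?_)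
      simpa [ha] using hsub a
    · refine (hYI a b hab).mono (hsub a) ?_
      simpa [hb] using hsub b
  · intro a b hab
    exact (hYI a b hab).mono (hsub a) Set.subset_union_right
  · refine ⟨x, ?_, w, ?_, hxw⟩
    · simp [hxI]
    · simpa [hij.symm] using hwj
  · have hcov : (⋃ l, if l = i then X i ∪ Wi ∪ I else if l = j then X j ∪ Wj else X l) ⊆
        (⋃ l, X l) ∪ (I ∪ (Wi ∪ Wj)) := by
      refine Set.iUnion_subset fun l => ?_
      have hX : ∀ l, X l ⊆ ⋃ l, X l := Set.subset_iUnion X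
      split_ifs
      · rintro y ((hy | hy) | hy)
        · exact Or.inl (hX _ hy)
        · exact Or.inr (Or.inr (Or.inl hy))
        · exact Or.inr (Or.inl hy)
      · rintro y (hy | hy)
        · exact Or.inl (hX _ hy)
        · exact Or.inr (Or.inr (Or.inr hy))
      · exact fun y hy => Or.inl (hX _ hy)
    have hI : I.ncard ≤ T + 1 :=
      (Set.ncard_le_ncard hIs (Set.toFinite _)).trans ((ncard_support_le p).trans (by omega))
    have h1 := Set.ncard_le_ncard hcov (Set.toFinite _)
    have h2 := Set.ncard_union_le (⋃ l, X l) (I ∪ (Wi ∪ Wj))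
    have h3 := Set.ncard_union_le I (Wi ∪ Wj)
    have h4 := Set.ncard_union_le Wi Wj
    dsimp only
    omega

/-- If at every stage the cores of any two branches are joined by a short walk avoiding all other
branches and their (shrinking) cores, then there is a small complete minor. -/
theorem hasKtMinorOfOrder_of_walks {V : Type*} [Finite V] (G : SimpleGraph V) (t R T : ℕ)
    (c : Fin t → V) (B : ℕ → Fin t → Set V)
    (hcB : ∀ k i, c i ∈ B k i) (hmono : ∀ k i, B (k + 1) i ⊆ B k i)
    (hBB : ∀ k i j, i ≠ j → Disjoint (B k i) (B k j))
    (hB : ∀ k i, ∀ u ∈ B k i,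
      ∃ p : G.Walk (c i) u, p.length ≤ R ∧ ∀ x ∈ p.support, x ∈ B k i)
    (hwalk : ∀ k < t * t, ∀ X : Fin t → Set V, (∀ i j, i ≠ j → Disjoint (X i) (B k j)) →
      (⋃ l, X l).ncard ≤ t + t * t * (T + 1 + 2 * (R + 1)) → ∀ i j, i ≠ j →
      ∃ p : G.Walk (c i) (c j), p.length ≤ T ∧
        ∀ x ∈ p.support, ∀ l, l ≠ i → l ≠ j → x ∉ X l ∪ B (k + 1) l) :
    HasKtMinorOfOrder G t ((t + t * t * (T + 1 + 2 * (R + 1)) : ℕ) : ℝ) := by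
  classical
  have key : ∀ L : List (Fin t × Fin t), (∀ e ∈ L, e.1 ≠ e.2) → L.length ≤ t * t →
      ∃ X : Fin t → Set V, (∀ i, c i ∈ X i) ∧ (∀ i, (G.induce (X i)).Connected) ∧
        (∀ a b, a ≠ b → Disjoint (X a) (X b)) ∧
        (∀ a b, a ≠ b → Disjoint (X a) (B L.length b)) ∧
        (∀ e ∈ L, ∃ x ∈ X e.1, ∃ y ∈ X e.2, G.Adj x y) ∧
        (⋃ l, X l).ncard ≤ t + L.length * (T + 1 + 2 * (R + 1)) := by
    intro L
    induction L with
    | nil =>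
      intro _ _
      have hne : ∀ a b, a ≠ b → c a ∉ B 0 b := fun a b hab =>
        Set.disjoint_left.1 (hBB 0 a b hab) (hcB 0 a)
      refine ⟨fun i => {c i}, fun i => rfl, fun i => SimpleGraph.Connected.of_subsingleton,
        fun a b hab => ?_, fun a b hab => ?_, by simp, ?_⟩
      · exact Set.disjoint_singleton.2 fun h => hne a b hab (h ▸ hcB 0 b)
      · exact Set.disjoint_singleton_left.2 (hne a b hab)
      · have h : (⋃ l, {c l} : Set V) = Set.range c := by ext; simp [eq_comm]
        rw [h, ← Set.image_univ]
        refine (Set.ncard_image_le (Set.toFinite _)).trans ?_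
        simp
    | cons e L ih =>
      intro hne hlen
      rw [List.length_cons] at hlen
      obtain ⟨X, hcX, hXc, hXX, hXB, hadj, hcard⟩ :=
        ih (fun e he => hne e (List.mem_cons_of_mem _ he)) (by omega)
      have he : e.1 ≠ e.2 := hne e List.mem_cons_self
      obtain ⟨p, hp, hpl⟩ := hwalk L.length (by omega) X hXB
        (hcard.trans (Nat.add_le_add_left (Nat.mul_le_mul_right _ (by omega)) _)) e.1 e.2 he
      obtain ⟨X', hsub, hc', hXX', hXB', hadj', hcard'⟩ :=
        exists_branch_extension G X (B (L.length + 1)) c R T hXc hcX hXX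
          (fun a b hab => (hXB a b hab).mono_right (hmono _ b)) (hBB _) (hB _) he p hp hpl
      refine ⟨X', fun i => hsub i (hcX i), hc', hXX', hXB', ?_, ?_⟩
      · intro e' he'
        rcases List.mem_cons.1 he' with rfl | he'
        · exact hadj'
        · obtain ⟨x, hx, y, hy, hxy⟩ := hadj e' he'
          exact ⟨x, hsub _ hx, y, hsub _ hy, hxy⟩
      · rw [List.length_cons]
        linarith
  have hlen : (Finset.univ.filter fun e : Fin t × Fin t => e.1 ≠ e.2).toList.length ≤ t * t := by
    rw [Finset.length_toList]
    exact (Finset.card_filter_le _ _).trans (by simp)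
  obtain ⟨X, hcX, hXc, hXX, -, hadj, hcard⟩ := key _ (by simp) hlen
  refine ⟨X, fun i => ⟨c i, hcX i⟩, fun a b hab => hXX a b hab, hXc,
    fun i j hij => hadj (i, j) (by simp [hij.ne]), ?_⟩
  exact_mod_cast hcard.trans (Nat.add_le_add_left (Nat.mul_le_mul_right _ hlen) _)

theorem gball_mono {V : Type*} (H : SimpleGraph V) (v : V) {r s : ℕ} (h : r ≤ s) :
    gball H v r ⊆ gball H v s :=
  fun _ ⟨p, hp⟩ => ⟨p, hp.trans h⟩

theorem self_mem_gball {V : Type*} (H : SimpleGraph V) (v : V) (r : ℕ) : v ∈ gball H v r :=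
  ⟨SimpleGraph.Walk.nil, by simp⟩

theorem gball_succ_subset {V : Type*} (H : SimpleGraph V) (v : V) (r : ℕ) :
    gball H v (r + 1) ⊆ gball H v r ∪ ⋃ x ∈ gball H v r, H.neighborSet x := by
  rintro u ⟨p, hp⟩
  by_cases hr : p.length ≤ r
  · exact Or.inl ⟨p, hr⟩
  · have hn : ¬ p.Nil := by
      rw [← SimpleGraph.Walk.length_eq_zero_iff]; omega
    refine Or.inr (Set.mem_biUnion (x := p.penultimate) ⟨p.dropLast, ?_⟩ (p.adj_penultimate hn))
    rw [SimpleGraph.Walk.dropLast, SimpleGraph.Walk.take_length]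
    omega

theorem ncard_biUnion_le_mul {α β : Type*} [Finite α] [Finite β] (s : Set α) (f : α → Set β)
    {Δ : ℝ} (hf : ∀ a ∈ s, ((f a).ncard : ℝ) ≤ Δ) :
    ((⋃ a ∈ s, f a).ncard : ℝ) ≤ s.ncard * Δ := by
  induction s, Set.toFinite s using Set.Finite.induction_on with
  | empty => simp
  | @insert a s ha hs ih =>
    rw [Set.biUnion_insert, Set.ncard_insert_of_notMem ha]
    have h1 : ((f a ∪ ⋃ x ∈ s, f x).ncard : ℝ) ≤ (f a).ncard + (⋃ x ∈ s, f x).ncard := by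
      exact_mod_cast Set.ncard_union_le _ _
    have h2 := ih fun x hx => hf x (Set.mem_insert_of_mem _ hx)
    have h3 := hf a (Set.mem_insert _ _)
    push_cast
    linarith

theorem ncard_gball_le {V : Type*} [Finite V] (H : SimpleGraph V) (v : V) {Δ : ℝ} (hΔ : 0 ≤ Δ)
    (hdeg : ∀ x, ((H.neighborSet x).ncard : ℝ) ≤ Δ) (r : ℕ) :
    ((gball H v r).ncard : ℝ) ≤ (1 + Δ) ^ r := by
  induction r with
  | zero =>
    have h : gball H v 0 ⊆ {v} := by
      rintro u ⟨p, hp⟩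
      exact (SimpleGraph.Walk.eq_of_length_eq_zero (by omega : p.length = 0)).symm
    simpa using Set.ncard_le_ncard h
  | succ r ih =>
    have h1 : ((gball H v (r + 1)).ncard : ℝ) ≤
        (gball H v r).ncard + (⋃ x ∈ gball H v r, H.neighborSet x).ncard := by
      exact_mod_cast (Set.ncard_le_ncard (gball_succ_subset H v r) (Set.toFinite _)).trans
        (Set.ncard_union_le _ _)
    have h2 := ncard_biUnion_le_mul (gball H v r) (fun x => H.neighborSet x) fun x _ => hdeg x
    calc ((gball H v (r + 1)).ncard : ℝ) ≤ (gball H v r).ncard * (1 + Δ) := by linarith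
      _ ≤ (1 + Δ) ^ r * (1 + Δ) := by gcongr
      _ = (1 + Δ) ^ (r + 1) := (pow_succ _ _).symm

theorem pow_le_ncard_gball {V : Type*} [Finite V] (H : SimpleGraph V) (v : V) {γ : ℝ}
    (hγ : 0 ≤ γ) (k : ℕ)
    (hexp : ∀ i : ℕ, 1 ≤ i → i + 1 ≤ k →
      ((gball H v (i + 1)).ncard : ℝ) ≥ (1 + γ) * (gball H v i).ncard) (r : ℕ) (hr : r + 1 ≤ k) :
    (1 + γ) ^ r ≤ ((gball H v (r + 1)).ncard : ℝ) := by
  induction r with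
  | zero =>
    have : 0 < (gball H v 1).ncard :=
      (Set.ncard_pos (Set.toFinite _)).2 ⟨v, self_mem_gball H v 1⟩
    simpa using (by exact_mod_cast this : (1 : ℝ) ≤ (gball H v 1).ncard)
  | succ r ih =>
    calc (1 + γ) ^ (r + 1) = (1 + γ) * (1 + γ) ^ r := pow_succ' _ _
      _ ≤ (1 + γ) * (gball H v (r + 1)).ncard := by gcongr; exact ih (by omega)
      _ ≤ _ := hexp (r + 1) (by omega) hr

theorem exists_walk_in_image_gball {V : Type*} (G : SimpleGraph V) (S : Set V) (v : S) (r : ℕ)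
    {u : V} (hu : u ∈ Subtype.val '' gball (G.induce S) v r) :
    ∃ p : G.Walk v u, p.length ≤ r ∧
      ∀ x ∈ p.support, x ∈ Subtype.val '' gball (G.induce S) v r := by
  classical
  obtain ⟨u, ⟨p, hp⟩, rfl⟩ := hu
  let f : G.induce S →g G := (SimpleGraph.Embedding.induce S).toHom
  have hf : ∃ q : G.Walk (f v) (f u), q.length ≤ r ∧ ∀ x ∈ q.support, ∃ y ∈ p.support, f y = x :=
    ⟨p.map f, by simpa using hp, fun x hx => by simpa using hx⟩
  obtain ⟨q, hq, hqs⟩ := hf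
  refine ⟨q, hq, fun x hx => ?_⟩
  obtain ⟨y, hy, rfl⟩ := hqs x hx
  exact ⟨y, ⟨p.takeUntil y hy, (p.length_takeUntil_le_length hy).trans hp⟩, rfl⟩

/-- The set reached from `A` in `s` steps without entering `F`. -/
def growAvoiding {V : Type*} (G : SimpleGraph V) (F A : Set V) : ℕ → Set V
  | 0 => A
  | s + 1 => growAvoiding G F A s ∪ (nbhd G (growAvoiding G F A s) \ F)

theorem exists_walk_of_mem_growAvoiding {V : Type*} (G : SimpleGraph V) (F A : Set V)
    (hAF : Disjoint A F) (c : V) (R : ℕ)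
    (hA : ∀ u ∈ A, ∃ p : G.Walk c u, p.length ≤ R ∧ ∀ x ∈ p.support, x ∈ A) (s : ℕ) :
    ∀ u ∈ growAvoiding G F A s,
      ∃ p : G.Walk c u, p.length ≤ R + s ∧ ∀ x ∈ p.support, x ∉ F := by
  induction s with
  | zero =>
    intro u hu
    obtain ⟨p, hp, hpA⟩ := hA u hu
    exact ⟨p, hp, fun x hx => Set.disjoint_left.1 hAF (hpA x hx)⟩
  | succ s ih =>
    rintro u (hu | ⟨⟨-, w, hw, hwu⟩, huF⟩)
    · obtain ⟨p, hp, hpF⟩ := ih u hu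
      exact ⟨p, by omega, hpF⟩
    · obtain ⟨p, hp, hpF⟩ := ih w hw
      refine ⟨p.concat hwu, by rw [SimpleGraph.Walk.length_concat]; omega, fun x hx => ?_⟩
      rw [SimpleGraph.Walk.support_concat, List.mem_append, List.mem_singleton] at hx
      rcases hx with hx | rfl
      · exact hpF x hx
      · exact huF

theorem subset_growAvoiding {V : Type*} (G : SimpleGraph V) (F A : Set V) (s : ℕ) :
    A ⊆ growAvoiding G F A s := by
  induction s with
  | zero => exact subset_rfl
  | succ s ih => exact ih.trans Set.subset_union_left

/-- If `F` is small compared to `A`, growing while avoiding `F` loses at most half of the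
expansion. -/
theorem ncard_growAvoiding_succ {V : Type*} [Finite V] (G : SimpleGraph V) (F A : Set V) {e f : ℝ}
    (hef : e ≤ f) (hF : (F.ncard : ℝ) ≤ e * A.ncard) (he : 0 ≤ e) (s : ℕ)
    (hexp : ((nbhd G (growAvoiding G F A s)).ncard : ℝ) ≥
      2 * f * (growAvoiding G F A s).ncard) :
    (1 + f) * ((growAvoiding G F A s).ncard : ℝ) ≤ (growAvoiding G F A (s + 1)).ncard := by
  set U := growAvoiding G F A s with hU
  have hA : (A.ncard : ℝ) ≤ U.ncard := by
    exact_mod_cast Set.ncard_le_ncard (subset_growAvoiding G F A s) (Set.toFinite _)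
  have hdis : Disjoint U (nbhd G U \ F) :=
    Set.disjoint_left.2 fun x hx hx' => hx'.1.1 hx
  have h1 : (growAvoiding G F A (s + 1)).ncard = U.ncard + (nbhd G U \ F).ncard :=
    Set.ncard_union_eq hdis (Set.toFinite _) (Set.toFinite _)
  have h2 : ((nbhd G U).ncard : ℝ) ≤ (nbhd G U \ F).ncard + F.ncard := by
    exact_mod_cast Set.ncard_le_ncard_sdiff_add_ncard _ _ (Set.toFinite _)
  have h3 : e * (A.ncard : ℝ) ≤ f * U.ncard :=
    mul_le_mul hef hA (by positivity) (he.trans hef)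
  rw [h1]
  push_cast
  nlinarith

theorem two_pow_lt_one_add_pow {x e : ℝ} (hx : 0 < x) (he : 0 ≤ e) {J : ℕ}
    (hJ : e * (1 / x + 1) < J) : (2 : ℝ) ^ e < (1 + x) ^ J := by
  have hp : (1 : ℝ) ≤ 1 / x + 1 := le_add_of_nonneg_left (by positivity)
  have h2 : (2 : ℝ) ≤ (1 + x) ^ (1 / x + 1) := by
    refine le_trans ?_ (one_add_mul_self_le_rpow_one_add (by linarith) hp)
    have : (1 / x + 1) * x = 1 + x := by field_simp
    linarith
  calc (2 : ℝ) ^ e ≤ ((1 + x) ^ (1 / x + 1)) ^ e := rpow_le_rpow (by norm_num) h2 he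
    _ = (1 + x) ^ (e * (1 / x + 1)) := by rw [← rpow_mul (by linarith), mul_comm]
    _ < (1 + x) ^ (J : ℝ) := rpow_lt_rpow_of_exponent_lt (by linarith) hJ
    _ = (1 + x) ^ J := rpow_natCast _ _

/-- A sequence growing by the factor `1 + x` below `z` climbs from `b` to above `z ≤ b * 2 ^ e`
in about `e * (1 / x + 1)` steps. -/
theorem exists_gt_of_growth {a : ℕ → ℝ} {z b x e : ℝ} (hb : 0 < b) (hx : 0 < x) (he : 0 ≤ e)
    (hz : z ≤ b * 2 ^ e) (s₀ : ℕ) (hs₀ : b ≤ a s₀)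
    (hgrow : ∀ s, a s ≤ z → (1 + x) * a s ≤ a (s + 1)) :
    ∃ s : ℕ, (s : ℝ) ≤ s₀ + (e * (1 / x + 1) + 1) ∧ z < a s := by
  have hJ := Nat.lt_floor_add_one (e * (1 / x + 1))
  have hJ' := Nat.floor_le (show 0 ≤ e * (1 / x + 1) by positivity)
  set J := ⌊e * (1 / x + 1)⌋₊ + 1 with hJdef
  by_contra! hcon
  have hall : ∀ r ≤ J, a (s₀ + r) ≤ z := fun r hr => hcon _ <| by
    have : (r : ℝ) ≤ J := by exact_mod_cast hr
    rw [hJdef] at this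
    push_cast at this ⊢
    linarith
  have hpow : ∀ r ≤ J, b * (1 + x) ^ r ≤ a (s₀ + r) := by
    intro r
    induction r with
    | zero => intro _; simpa using hs₀
    | succ r ih =>
      intro hr
      calc b * (1 + x) ^ (r + 1) = (1 + x) * (b * (1 + x) ^ r) := by ring
        _ ≤ (1 + x) * a (s₀ + r) := by gcongr; exact ih (by omega)
        _ ≤ a (s₀ + (r + 1)) := hgrow _ (hall r (by omega))
  have h1 := two_pow_lt_one_add_pow hx he (J := J) (by rw [hJdef]; push_cast; exact hJ)
  have h2 := hpow J le_rfl
  have h3 := hall J le_rfl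
  have h4 := mul_lt_mul_of_pos_left h1 hb
  linarith

/-- Growth with rate `c * 2 ^ d` up to size `m / 2 ^ 2 ^ d`, for all `d ≤ D`, exceeds `m / 2`
quickly. -/
theorem exists_gt_half {a : ℕ → ℝ} {m M c : ℝ} (hc : 0 < c) (hM : 0 ≤ M) (hm : m = 2 ^ M)
    (D : ℕ) (ha : 1 ≤ a 0)
    (hgrow : ∀ d ≤ D, ∀ s, a s ≤ m / 2 ^ (2 ^ d : ℕ) → (1 + c * 2 ^ d) * a s ≤ a (s + 1)) :
    ∃ s : ℕ, (s : ℝ) ≤ M * (1 / (c * 2 ^ D) + 1) + 1 + D * (1 / c + 1) + 2 ^ D ∧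
      m / 2 < a s := by
  have hm0 : 0 < m := by rw [hm]; positivity
  have key : ∀ j ≤ D, ∃ s : ℕ, (s : ℝ) ≤ M * (1 / (c * 2 ^ D) + 1) + 1 + j * (1 / c + 1) +
      (2 ^ D - 2 ^ (D - j)) ∧ m / 2 ^ (2 ^ (D - j) : ℕ) < a s := by
    intro j
    induction j with
    | zero =>
      intro _
      obtain ⟨s, hs, hs'⟩ := exists_gt_of_growth (a := a) (z := m / 2 ^ (2 ^ D : ℕ)) (b := 1)
        (x := c * 2 ^ D) (e := M) one_pos (by positivity) hM
        (by rw [one_mul, ← hm]; exact div_le_self hm0.le (one_le_pow₀ (by norm_num))) 0 ha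
        (hgrow D le_rfl)
      refine ⟨s, ?_, hs'⟩
      simp only [Nat.cast_zero, zero_add, Nat.sub_zero, sub_self, zero_mul, add_zero] at hs ⊢
      exact hs
    | succ j ih =>
      intro hj
      obtain ⟨s₀, hs₀, hs₀'⟩ := ih (by omega)
      obtain ⟨d, hd⟩ : ∃ d, D - j = d + 1 := ⟨D - j - 1, by omega⟩
      have hd' : D - (j + 1) = d := by omega
      rw [hd] at hs₀ hs₀'
      rw [hd']
      obtain ⟨s, hs, hs'⟩ := exists_gt_of_growth (a := a) (z := m / 2 ^ (2 ^ d : ℕ))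
        (b := m / 2 ^ (2 ^ (d + 1) : ℕ)) (x := c * 2 ^ d) (e := 2 ^ d) (by positivity)
        (by positivity) (by positivity)
        (by
          have : (2 : ℝ) ^ ((2 : ℝ) ^ d) = 2 ^ (2 ^ d : ℕ) := by
            rw [← rpow_natCast 2 (2 ^ d)]; push_cast; rfl
          rw [this, pow_succ 2 d, pow_mul, sq]
          apply le_of_eq
          field_simp) s₀ hs₀'.le (hgrow d (by omega))
      refine ⟨s, hs.trans ?_, hs'⟩
      have h1 : (2 : ℝ) ^ d * (1 / (c * 2 ^ d) + 1) = 1 / c + 2 ^ d := by field_simp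
      rw [h1]
      rw [pow_succ] at hs₀
      push_cast
      linarith
  obtain ⟨s, hs, hs'⟩ := key D le_rfl
  refine ⟨s, hs.trans ?_, by simpa using hs'⟩
  simp

/-- In an expander, two sets much larger than `F` are joined by a short walk avoiding `F`. -/
theorem exists_short_walk_avoiding {V : Type*} [Finite V] (G : SimpleGraph V) {δ : ℝ} {n : ℕ}
    (hG : IsDeltaNExpander G δ n) (hδ : 0 < δ) (hL : 0 < logb 2 n) (D : ℕ)
    (hD : (D : ℝ) ≤ logb 2 (logb 2 (Nat.card V)) - 1) {F A A' : Set V}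
    (hAF : Disjoint A F) (hAF' : Disjoint A' F) {c c' : V} (R : ℕ) (hc : c ∈ A) (hc' : c' ∈ A')
    (hA : ∀ u ∈ A, ∃ p : G.Walk c u, p.length ≤ R ∧ ∀ x ∈ p.support, x ∈ A)
    (hA' : ∀ u ∈ A', ∃ p : G.Walk c' u, p.length ≤ R ∧ ∀ x ∈ p.support, x ∈ A')
    (hF : (F.ncard : ℝ) ≤ δ / (2 * logb 2 n) * A.ncard)
    (hF' : (F.ncard : ℝ) ≤ δ / (2 * logb 2 n) * A'.ncard) (T : ℕ)
    (hT : logb 2 (Nat.card V) * (1 / (δ / (2 * logb 2 n) * 2 ^ D) + 1) + 1 +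
      D * (1 / (δ / (2 * logb 2 n)) + 1) + 2 ^ D ≤ T) :
    ∃ p : G.Walk c c', p.length ≤ 2 * (R + T) ∧ ∀ x ∈ p.support, x ∉ F := by
  classical
  have hV : 1 ≤ Nat.card V := Nat.card_pos_iff.2 ⟨⟨c⟩, inferInstance⟩
  have hV' : (1 : ℝ) ≤ Nat.card V := by exact_mod_cast hV
  have grow : ∀ A : Set V, ∀ c ∈ A, Disjoint A F →
      (F.ncard : ℝ) ≤ δ / (2 * logb 2 n) * A.ncard →
      (∀ u ∈ A, ∃ p : G.Walk c u, p.length ≤ R ∧ ∀ x ∈ p.support, x ∈ A) →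
      ∃ s ≤ T, (Nat.card V : ℝ) / 2 < (growAvoiding G F A s).ncard := by
    intro A c hc hAF hF hA
    obtain ⟨s, hs, hs'⟩ := exists_gt_half (a := fun s => ((growAvoiding G F A s).ncard : ℝ))
      (m := Nat.card V) (M := logb 2 (Nat.card V)) (c := δ / (2 * logb 2 n)) (by positivity)
      (logb_nonneg (by norm_num) hV') (rpow_logb (by norm_num) (by norm_num) (by linarith)).symm D
      (by exact_mod_cast (Set.ncard_pos (Set.toFinite _)).2 ⟨c, hc⟩)
      (by
        intro d hd s hs
        refine ncard_growAvoiding_succ G F A (e := δ / (2 * logb 2 n)) ?_ hF (by positivity) s ?_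
        · exact le_mul_of_one_le_right (by positivity) (one_le_pow₀ (by norm_num))
        · have hd' : (d : ℝ) ≤ D := by exact_mod_cast hd
          have := hG d (hd'.trans hD) _ hs
          convert this using 2
          field_simp)
    exact ⟨s, by exact_mod_cast hs.trans hT, hs'⟩
  obtain ⟨s, hs, hs'⟩ := grow A c hc hAF hF hA
  obtain ⟨r, hr, hr'⟩ := grow A' c' hc' hAF' hF' hA'
  obtain ⟨u, hu, hu'⟩ : (growAvoiding G F A s ∩ growAvoiding G F A' r).Nonempty := by
    rw [← Set.not_disjoint_iff_nonempty_inter]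
    intro hdis
    have h1 := Set.ncard_union_eq hdis (Set.toFinite _) (Set.toFinite _)
    have h2 := Set.ncard_le_card (growAvoiding G F A s ∪ growAvoiding G F A' r)
    rw [h1] at h2
    have h3 : ((growAvoiding G F A s).ncard : ℝ) + (growAvoiding G F A' r).ncard ≤ Nat.card V := by
      exact_mod_cast h2
    linarith
  obtain ⟨p, hp, hpF⟩ := exists_walk_of_mem_growAvoiding G F A hAF c R hA s u hu
  obtain ⟨p', hp', hpF'⟩ := exists_walk_of_mem_growAvoiding G F A' hAF' c' R hA' r u hu'
  refine ⟨p.append p'.reverse, ?_, fun x hx => ?_⟩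
  · rw [SimpleGraph.Walk.length_append, SimpleGraph.Walk.length_reverse]
    omega
  · rw [SimpleGraph.Walk.mem_support_append_iff, SimpleGraph.Walk.support_reverse,
      List.mem_reverse] at hx
    exact hx.elim (hpF x) (hpF' x)

theorem eventually_pow_lt_two_rpow (K : ℕ) :
    ∀ᶠ l : ℝ in Filter.atTop, 25 * l ^ 3 * (2 * l) ^ K < (2 : ℝ) ^ l := by
  have h := (isLittleO_pow_exp_pos_mul_atTop (b := log 2) (K + 3) (log_pos one_lt_two)).def
    (c := 1 / (50 * 2 ^ K)) (by positivity)
  filter_upwards [h, Filter.eventually_ge_atTop 1] with l hl hl1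
  have h2 : (2 : ℝ) ^ l = exp (log 2 * l) := rpow_def_of_pos (by norm_num) l
  rw [norm_of_nonneg (by positivity), norm_of_nonneg (by positivity), ← h2] at hl
  have h3 : (0 : ℝ) < 2 ^ l := by positivity
  calc 25 * l ^ 3 * (2 * l) ^ K = 25 * 2 ^ K * l ^ (K + 3) := by ring
    _ ≤ 25 * 2 ^ K * (1 / (50 * 2 ^ K) * 2 ^ l) := by gcongr
    _ = 2 ^ l / 2 := by field_simp; norm_num
    _ < 2 ^ l := by linarith

theorem le_two_rpow {l : ℝ} (hl : 1 ≤ l) : l ≤ (2 : ℝ) ^ l := by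
  have h := one_add_mul_self_le_rpow_one_add (s := 1) (by norm_num) hl
  norm_num at h
  linarith

/-- The core of one stage is negligible compared to the core of the preceding stage. -/
theorem core_growth {δ l γ : ℝ} {t q r : ℕ} (hδ : 0 < δ) (h8 : 8 ≤ l) (h90 : 90 / δ ≤ l)
    (ht : (t : ℝ) ≤ l) (hq : l ^ 4 ≤ q) (hr : 1 ≤ r) (hγ : δ / (5 * l ^ 2) ≤ γ) :
    ((2 : ℝ) ^ l) ^ 2 + t * (((2 : ℝ) ^ l) ^ 5) ^ r ≤
      δ / (2 * (2 : ℝ) ^ l) * (1 + γ) ^ (q * r - 1) := by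
  have hr' : (1 : ℝ) ≤ r := by exact_mod_cast hr
  have hlL := le_two_rpow (show 1 ≤ l by linarith)
  have hq1 : 1 ≤ q * r := by
    have : (1 : ℝ) ≤ q := le_trans (one_le_pow₀ (by linarith)) hq
    exact Nat.mul_pos (by exact_mod_cast this) hr
  have hδl : 90 ≤ l * δ := (div_le_iff₀ hδ).1 h90
  have h1 : ((2 : ℝ) ^ l) ^ (9 * r) ≤ (1 + γ) ^ (q * r - 1) := by
    have h := two_pow_lt_one_add_pow (x := δ / (5 * l ^ 2)) (e := l * (9 * r)) (J := q * r - 1)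
      (by positivity) (by positivity) (by
        have e1 : 1 / (δ / (5 * l ^ 2)) ≤ l ^ 3 / 18 := by
          rw [one_div_div, div_le_div_iff₀ hδ (by norm_num)]
          nlinarith [sq_nonneg l]
        rw [Nat.cast_sub hq1]
        push_cast
        have e2 : l * (9 * r) * (1 / (δ / (5 * l ^ 2)) + 1) ≤ l * (9 * r) * (l ^ 3 / 18 + 1) := by
          gcongr
        have e3 : l ^ 4 * r ≤ q * r := by gcongr
        have e4 : 512 * l ≤ l ^ 4 := by
          have : (8 : ℝ) ^ 3 ≤ l ^ 3 := by gcongr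
          nlinarith
        have e5 : 1 < r * (l ^ 4 / 2 - 9 * l) := by nlinarith
        nlinarith)
    calc ((2 : ℝ) ^ l) ^ (9 * r) = 2 ^ (l * (9 * r)) := by
          rw [← rpow_natCast, ← rpow_mul (by norm_num)]; push_cast; rfl
      _ ≤ (1 + δ / (5 * l ^ 2)) ^ (q * r - 1) := h.le
      _ ≤ (1 + γ) ^ (q * r - 1) := by gcongr
  set L := (2 : ℝ) ^ l with hL
  have hL1 : 1 ≤ L := by linarith
  have h2 : L ^ 2 ≤ L * L ^ (5 * r) := by
    rw [← pow_succ']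
    exact pow_le_pow_right₀ hL1 (by omega)
  have h3 : (t : ℝ) * (L ^ 5) ^ r ≤ L * L ^ (5 * r) := by
    rw [← pow_mul]
    gcongr
    exact ht.trans hlL
  have h4 : 2 * L ≤ δ * (L * L) := by nlinarith
  rw [div_mul_eq_mul_div, le_div_iff₀ (by positivity)]
  calc (L ^ 2 + t * (L ^ 5) ^ r) * (2 * L) ≤ (L * (L * L ^ (5 * r))) * (δ * (L * L)) := by
        gcongr
        have : 0 ≤ L * L ^ (5 * r) := by positivity
        nlinarith
    _ = δ * L ^ (5 * r + 4) := by ring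
    _ ≤ δ * L ^ (9 * r) := by gcongr; omega
    _ ≤ δ * (1 + γ) ^ (q * r - 1) := by gcongr

/-- The number of growth steps needed in an expander is `O(log n * log log n / δ)`. -/
theorem growth_time_le {δ l L M : ℝ} {D : ℕ} (hδ : 0 < δ) (h8 : 8 ≤ l) (hδl : δ ≤ l)
    (hlL : l ≤ L) (hM : 0 < M) (hML : M ≤ L) (hDl : (D : ℝ) ≤ l) (hD : M ≤ 4 * 2 ^ D)
    (hD' : 2 ^ D ≤ M) :
    M * (1 / (δ / (2 * L) * 2 ^ D) + 1) + 1 + D * (1 / (δ / (2 * L)) + 1) + 2 ^ D ≤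
      7 * (l * L / δ) := by
  have hL : 0 < L := by linarith
  have h1 : M * (1 / (δ / (2 * L) * 2 ^ D)) ≤ l * L / δ := by
    have : M * (1 / (δ / (2 * L) * 2 ^ D)) = (M / 2 ^ D) * (2 * L) / δ := by field_simp
    rw [this]
    have h4 : M / 2 ^ D ≤ 4 := by rwa [div_le_iff₀ (by positivity)]
    have h5 : M / 2 ^ D * (2 * L) ≤ l * L := by nlinarith
    gcongr
  have h2 : D * (1 / (δ / (2 * L))) ≤ 2 * (l * L / δ) := by
    have : D * (1 / (δ / (2 * L))) = 2 * (D * L / δ) := by field_simp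
    rw [this]
    gcongr
  have h3 : L ≤ l * L / δ := by
    rw [le_div_iff₀ hδ]
    nlinarith
  nlinarith

set_option maxHeartbeats 1000000 in
/-- The quantitative form of the main theorem: it holds as soon as `l = log log n` is large
compared to `δ`, `1 / δ` and `t`. The core of branch `i` at stage `k` is the ball of radius
`q ^ (t * t + 1 - k)` around the center of `S i`; each core dwarfs those of the next stage. -/
theorem hasKtMinorOfOrder_of_large {δ : ℝ} (hδ : 0 < δ) {t : ℕ} (ht : 3 ≤ t) {n m : ℕ} {l : ℝ}
    (hl : l = logb 2 (logb 2 n)) (h8 : 8 ≤ l) (hδl : δ ≤ l) (h90 : 90 / δ ≤ l) (htl : (t : ℝ) ≤ l)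
    (hpow : 25 * l ^ 3 * (2 * l) ^ (4 * (t * t + 1)) < (2 : ℝ) ^ l) (hLpos : 0 < logb 2 n)
    (hm : (2 : ℝ) ^ (logb 2 n / (logb 2 (logb 2 n)) ^ 2) ≤ (m : ℝ)) (hmn : m ≤ n)
    (G : SimpleGraph (Fin m)) (hG : IsDeltaNExpander G δ n) (S : Fin t → Set (Fin m))
    (hS : Pairwise (Function.onFun Disjoint S))
    (hball : ∀ i, GraphIsExpandingBall (G.induce (S i)) (δ * logb 2 m / (5 * logb 2 n)))
    (hcard : ∀ i, (m : ℝ) ^ ((1 : ℝ) / 5) ≤ ((S i).ncard : ℝ))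
    (hdeg : ∀ i, ∀ x : (S i),
      (((G.induce (S i)).neighborSet x).ncard : ℝ) ≤ (logb 2 m) ^ 4) :
    HasKtMinorOfOrder G t (24 * (t ^ 2 / δ) * logb 2 n * logb 2 (logb 2 n)) := by
  set L := logb 2 n with hLdef
  set M := logb 2 (m : ℝ) with hMdef
  rw [← hl] at hm ⊢
  have hL2 : (2 : ℝ) ^ l = L := by rw [hl]; exact rpow_logb (by norm_num) (by norm_num) hLpos
  have hlL : l ≤ L := hL2 ▸ le_two_rpow (by linarith)
  have hL1 : 1 ≤ L := by linarith
  have hm0 : (0 : ℝ) < m := lt_of_lt_of_le (by positivity) hm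
  have hM2 : (2 : ℝ) ^ M = m := rpow_logb (by norm_num) (by norm_num) hm0
  have hLM : L / l ^ 2 ≤ M := (le_logb_iff_rpow_le (by norm_num) hm0).2 hm
  have hML : M ≤ L := logb_le_logb_of_le (by norm_num) hm0 (by exact_mod_cast hmn)
  -- radii of the cores
  set q : ℕ := ⌈l⌉₊ ^ 4 with hq
  have hceil : l ≤ ⌈l⌉₊ := Nat.le_ceil l
  have hceil2 : (⌈l⌉₊ : ℝ) ≤ 2 * l := by
    have := Nat.ceil_lt_add_one (show 0 ≤ l by linarith)
    linarith
  have hlq : l ^ 4 ≤ q := by rw [hq]; push_cast; gcongr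
  have hq1 : 1 ≤ q := by
    have : (1 : ℝ) ≤ q := le_trans (one_le_pow₀ (by linarith)) hlq
    exact_mod_cast this
  set ρ : ℕ → ℕ := fun k => q ^ (t * t + 1 - k) with hρ
  have hρanti : ∀ k, ρ (k + 1) ≤ ρ k := fun k => Nat.pow_le_pow_right hq1 (by omega)
  have hρ0 : ∀ k, ρ k ≤ ρ 0 := fun k => Nat.pow_le_pow_right hq1 (by omega)
  have hρ1 : ∀ k, 1 ≤ ρ k := fun k => Nat.one_le_pow _ _ hq1
  have hρstep : ∀ k < t * t, ρ k = q * ρ (k + 1) := by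
    intro k hk
    simp only [hρ]
    rw [← pow_succ']
    congr 1
    omega
  have hρ0L : 25 * l ^ 3 * (ρ 0 : ℝ) < L := by
    refine lt_of_le_of_lt ?_ (hL2 ▸ hpow)
    gcongr
    simp only [hρ, hq, Nat.sub_zero]
    push_cast
    rw [← pow_mul]
    gcongr
  have hl3 : 1 ≤ l ^ 3 := one_le_pow₀ (by linarith)
  have hRL : (ρ 0 : ℝ) ≤ L := by nlinarith [(ρ 0).cast_nonneg (α := ℝ)]
  have hM25 : 25 * l * (ρ 0 : ℝ) < M := by
    refine lt_of_lt_of_le ?_ hLM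
    rw [lt_div_iff₀ (by positivity)]
    nlinarith
  have hρ0' : (1 : ℝ) ≤ ρ 0 := by exact_mod_cast hρ1 0
  have hM4 : 4 ≤ M := by nlinarith
  -- expansion and degree parameters
  have hγ : δ / (5 * l ^ 2) ≤ δ * M / (5 * L) := by
    rw [div_le_iff₀ (by positivity)] at hLM
    rw [div_le_div_iff₀ (by positivity) (by positivity)]
    nlinarith
  set γ := δ * M / (5 * L) with hγdef
  have hγ0 : 0 ≤ γ := le_trans (by positivity) hγ
  have hΔ : 1 + M ^ 4 ≤ L ^ 5 := by
    have h1 : M ^ 4 ≤ L ^ 4 := by gcongr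
    have h2 : 1 ≤ L ^ 4 := one_le_pow₀ hL1
    nlinarith
  choose c r hcr hexp using hball
  set B : ℕ → Fin t → Set (Fin m) :=
    fun k i => Subtype.val '' gball (G.induce (S i)) (c i) (ρ k) with hBdef
  have hBcard : ∀ k i, (B k i).ncard = (gball (G.induce (S i)) (c i) (ρ k)).ncard := fun k i =>
    Set.ncard_image_of_injective _ Subtype.val_injective
  have hupper : ∀ i s, ((gball (G.induce (S i)) (c i) s).ncard : ℝ) ≤ (L ^ 5) ^ s := fun i s =>
    (ncard_gball_le _ _ (by positivity) (hdeg i) s).trans (by gcongr)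
  have hradius : ∀ i, ρ 0 ≤ r i := by
    intro i
    by_contra! hlt
    have h1 : ((S i).ncard : ℝ) ≤ (L ^ 5) ^ (ρ 0) := by
      have h := hupper i (r i)
      rw [hcr i, Set.ncard_univ, Nat.card_coe_set_eq] at h
      exact h.trans (pow_le_pow_right₀ (one_le_pow₀ hL1) hlt.le)
    have h2 := (hcard i).trans h1
    rw [← hM2, ← hL2, ← rpow_mul (by norm_num), ← pow_mul, ← rpow_natCast, ← rpow_mul (by norm_num),
      rpow_le_rpow_left_iff (by norm_num)] at h2
    push_cast at h2
    linarith
  have hlower : ∀ k < t * t, ∀ i, (1 + γ) ^ (q * ρ (k + 1) - 1) ≤ ((B k i).ncard : ℝ) := by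
    intro k hk i
    have h1 := hρ1 k
    have h2 : ρ k - 1 + 1 = ρ k := by omega
    have h := pow_le_ncard_gball _ (c i) hγ0 (r i) (hexp i) (ρ k - 1)
      (h2 ▸ (hρ0 k).trans (hradius i))
    rw [hBcard, ← hρstep k hk]
    rwa [h2] at h
  -- number of growth steps
  have hlogM : 2 ≤ logb 2 M := by
    rw [le_logb_iff_rpow_le (by norm_num) (by linarith)]
    norm_num
    exact hM4
  have hlogMl : logb 2 M ≤ l := hl ▸ logb_le_logb_of_le (by norm_num) (by linarith) hML
  obtain ⟨D, hD1, hD2⟩ : ∃ D : ℕ, (D : ℝ) ≤ logb 2 M - 1 ∧ logb 2 M - 1 < D + 1 :=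
    ⟨_, Nat.floor_le (by linarith), Nat.lt_floor_add_one _⟩
  have hMlog : (2 : ℝ) ^ logb 2 M = M := rpow_logb (by norm_num) (by norm_num) (by linarith)
  have hDM : M ≤ 4 * 2 ^ D := by
    calc M = (2 : ℝ) ^ logb 2 M := hMlog.symm
      _ ≤ 2 ^ ((D + 2 : ℕ) : ℝ) := by
        apply rpow_le_rpow_of_exponent_le (by norm_num)
        push_cast
        linarith
      _ = 4 * 2 ^ D := by rw [rpow_natCast]; ring
  have hDM' : (2 : ℝ) ^ D ≤ M := by
    calc (2 : ℝ) ^ D = 2 ^ (D : ℝ) := (rpow_natCast _ _).symm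
      _ ≤ 2 ^ logb 2 M := rpow_le_rpow_of_exponent_le (by norm_num) (by linarith)
      _ = M := hMlog
  have htime := growth_time_le hδ h8 hδl hlL (by linarith) hML (by linarith) hDM hDM'
  set T := ⌈7 * (l * L / δ)⌉₊ with hT
  have hLQ : L ≤ l * L / δ := by
    rw [le_div_iff₀ hδ]
    nlinarith
  have hTle : (T : ℝ) ≤ 8 * (l * L / δ) := by
    have := Nat.ceil_lt_add_one (show 0 ≤ 7 * (l * L / δ) by positivity)
    linarith
  -- order of the minor
  have ht3 : (3 : ℝ) ≤ t := by exact_mod_cast ht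
  have horder : ((t + t * t * (2 * (ρ 0 + T) + 1 + 2 * (ρ 0 + 1)) : ℕ) : ℝ) ≤
      24 * (t ^ 2 / δ) * L * l := by
    push_cast
    have h1 : 2 * ((ρ 0 : ℝ) + T) + 1 + 2 * (ρ 0 + 1) ≤ 23 * (l * L / δ) := by linarith
    have h2 : (t : ℝ) ≤ t * t * (l * L / δ) := by
      have : 1 ≤ l * L / δ := by linarith
      nlinarith
    calc (t : ℝ) + t * t * (2 * (ρ 0 + T) + 1 + 2 * (ρ 0 + 1))
        ≤ t * t * (l * L / δ) + t * t * (23 * (l * L / δ)) := by gcongr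
      _ = 24 * (t ^ 2 / δ) * L * l := by field_simp; ring
  have horder' : 24 * (t ^ 2 / δ) * L * l ≤ L ^ 2 := by
    have h24 : 24 / δ ≤ l := le_trans (by gcongr; norm_num) h90
    have hl4 : l ^ 4 ≤ L := by
      have h1 : l ^ 4 ≤ 25 * l ^ 3 * (ρ 0 : ℝ) := by
        have h2 : l ^ 4 ≤ ρ 0 := hlq.trans (by exact_mod_cast Nat.le_self_pow (by omega) q)
        nlinarith
      linarith
    calc 24 * (t ^ 2 / δ) * L * l = (24 / δ) * t ^ 2 * l * L := by field_simp
      _ ≤ l * l ^ 2 * l * L := by gcongr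
      _ = l ^ 4 * L := by ring
      _ ≤ L ^ 2 := by nlinarith
  have hminor := hasKtMinorOfOrder_of_walks G t (ρ 0) (2 * (ρ 0 + T)) (fun i => (c i : Fin m)) B
    (fun k i => ⟨c i, self_mem_gball _ _ _, rfl⟩)
    (fun k i => Set.image_mono (gball_mono _ _ (hρanti k)))
    (fun k i j hij => (hS hij).mono (by rintro _ ⟨x, -, rfl⟩; exact x.2)
      (by rintro _ ⟨x, -, rfl⟩; exact x.2))
    (fun k i u hu => by
      obtain ⟨p, hp, hpB⟩ := exists_walk_in_image_gball G (S i) (c i) (ρ k) hu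
      exact ⟨p, hp.trans (hρ0 k), hpB⟩)
    (by
      intro k hk X hXB hXcard i j hij
      set F : Set (Fin m) := {x | ∃ a, a ≠ i ∧ a ≠ j ∧ x ∈ X a ∪ B (k + 1) a} with hFdef
      have hBS : ∀ k a, B k a ⊆ S a := by rintro k a _ ⟨x, -, rfl⟩; exact x.2
      have hBF : ∀ b, b = i ∨ b = j → Disjoint (B k b) F := by
        intro b hb
        refine Set.disjoint_right.2 ?_
        rintro x ⟨a, hai, haj, hx⟩
        have hab : a ≠ b := by rcases hb with rfl | rfl <;> assumption
        rcases hx with hx | hx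
        · exact Set.disjoint_left.1 (hXB a b hab) hx
        · exact fun hx' => Set.disjoint_left.1 (hS hab) (hBS _ _ hx) (hBS _ _ hx')
      have hFcard : (F.ncard : ℝ) ≤ L ^ 2 + t * (L ^ 5) ^ ρ (k + 1) := by
        have h1 : F ⊆ (⋃ a, X a) ∪ ⋃ a ∈ (Set.univ : Set (Fin t)), B (k + 1) a := by
          rintro x ⟨a, -, -, hx | hx⟩
          · exact Or.inl (Set.mem_iUnion.2 ⟨a, hx⟩)
          · exact Or.inr (Set.mem_biUnion (Set.mem_univ a) hx)
        have h2 : (F.ncard : ℝ) ≤ (⋃ a, X a).ncard +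
            (⋃ a ∈ (Set.univ : Set (Fin t)), B (k + 1) a).ncard := by
          exact_mod_cast (Set.ncard_le_ncard h1 (Set.toFinite _)).trans (Set.ncard_union_le _ _)
        have h3 := ncard_biUnion_le_mul (Set.univ : Set (Fin t)) (B (k + 1))
          (Δ := (L ^ 5) ^ ρ (k + 1)) (fun a _ => by rw [hBcard]; exact hupper a _)
        have h4 : ((⋃ a, X a).ncard : ℝ) ≤ L ^ 2 :=
          (Nat.cast_le.2 hXcard).trans (horder.trans horder')
        rw [Set.ncard_univ, Nat.card_fin] at h3
        linarith
      have hFB : ∀ b, (F.ncard : ℝ) ≤ δ / (2 * L) * (B k b).ncard := by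
        intro b
        have h := core_growth (q := q) (r := ρ (k + 1)) hδ h8 h90 htl hlq (hρ1 _) hγ
        rw [hL2] at h
        refine hFcard.trans (h.trans ?_)
        gcongr
        exact hlower k hk b
      obtain ⟨p, hp, hpF⟩ := exists_short_walk_avoiding G hG hδ hLpos D
        (by rw [Nat.card_fin]; exact hD1)
        (hBF i (Or.inl rfl)) (hBF j (Or.inr rfl)) (ρ 0)
        (c := c i) (c' := c j) ⟨c i, self_mem_gball _ _ _, rfl⟩ ⟨c j, self_mem_gball _ _ _, rfl⟩
        (fun u hu => by
          obtain ⟨p, hp, hpB⟩ := exists_walk_in_image_gball G (S i) (c i) (ρ k) hu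
          exact ⟨p, hp.trans (hρ0 k), hpB⟩)
        (fun u hu => by
          obtain ⟨p, hp, hpB⟩ := exists_walk_in_image_gball G (S j) (c j) (ρ k) hu
          exact ⟨p, hp.trans (hρ0 k), hpB⟩)
        (hFB i) (hFB j) T
        (by rw [Nat.card_fin]; exact htime.trans (Nat.le_ceil _))
      exact ⟨p, hp, fun x hx a hai haj hxa => hpF x hx ⟨a, hai, haj, hxa⟩⟩)
  obtain ⟨P, h1, h2, h3, h4, h5⟩ := hminor
  exact ⟨P, h1, h2, h3, h4, h5.trans horder⟩

/-- Claim 4.7: for large `n`, a `(δ,n)`-expander on `m` vertices with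
`2^{log n/(log log n)²} ≤ m ≤ n` having `t` disjoint sets inducing `γ`-expanding balls of
polynomial size and bounded degree has a `K_t`-minor of order `O((t²/δ)·log n·log log n)`. -/
theorem stmt_14 :
    ∃ C : ℝ, 0 < C ∧
      ∀ δ : ℝ, 0 < δ → ∀ t : ℕ, 3 ≤ t → ∃ n₀ : ℕ,
        ∀ n : ℕ, n₀ ≤ n → ∀ m : ℕ,
          (2 : ℝ) ^ (logb 2 n / (logb 2 (logb 2 n)) ^ 2) ≤ (m : ℝ) → m ≤ n →
            ∀ G : SimpleGraph (Fin m), IsDeltaNExpander G δ n →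
              ∀ S : Fin t → Set (Fin m),
                (Pairwise (Function.onFun Disjoint S)) →
                (∀ i, GraphIsExpandingBall (G.induce (S i)) (δ * logb 2 m / (5 * logb 2 n)) ∧
                  (m : ℝ) ^ ((1 : ℝ) / 5) ≤ ((S i).ncard : ℝ) ∧
                  ((S i).ncard : ℝ) ≤ (m : ℝ) ^ ((1 : ℝ) / 4) ∧
                  ∀ x : (S i),
                    (((G.induce (S i)).neighborSet x).ncard : ℝ) ≤ (logb 2 m) ^ 4) →
                  HasKtMinorOfOrder G t
                    (C * (t ^ 2 / δ) * logb 2 n * logb 2 (logb 2 n)) := by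
  refine ⟨24, by norm_num, fun δ hδ t ht => ?_⟩
  have hlog : Filter.Tendsto (fun n : ℕ => logb 2 (n : ℝ)) Filter.atTop Filter.atTop :=
    (tendsto_logb_atTop one_lt_two).comp tendsto_natCast_atTop_atTop
  have hloglog := (tendsto_logb_atTop one_lt_two).comp hlog
  have hev := (hlog.eventually_gt_atTop 0).and <| hloglog.eventually <|
    (Filter.eventually_ge_atTop 8).and <| (Filter.eventually_ge_atTop δ).and <|
    (Filter.eventually_ge_atTop (90 / δ)).and <| (Filter.eventually_ge_atTop (t : ℝ)).and <|
    eventually_pow_lt_two_rpow (4 * (t * t + 1))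
  obtain ⟨n₀, hn₀⟩ := Filter.eventually_atTop.1 hev
  refine ⟨n₀, fun n hn m hm hmn G hG S hS hball => ?_⟩
  obtain ⟨hL, h8, hδl, h90, htl, hpow⟩ := hn₀ n hn
  exact hasKtMinorOfOrder_of_large hδ ht rfl h8 hδl h90 htl hpow hL hm hmn G hG S hS
    (fun i => (hball i).1) (fun i => (hball i).2.1) fun i => (hball i).2.2.2
end

section
/- For all δ > 0 there exists m₀ = m₀(δ) such that the following holds for every δ-expander G on m ≥ m₀ vertices: if u and v are two distinct vertices of G each of degree at least (log m)⁴, and W is any vertex set of G with |W| ≤ (log m)² and u, v ∉ W, then the graph obtained from G by deleting W contains a path from u to v of length at most (20/δ)·log m·(log log m)³. -/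
open Real

/-- The vertices of `Wᶜ` reachable from `u` inside `G.induce Wᶜ` by a walk of length at
most `k`, as a subset of the vertices of `G`. -/
def ballAvoiding {V : Type*} (G : SimpleGraph V) (W : Set V) {u : V} (hu : u ∉ W) (k : ℕ) :
    Set V :=
  {x | ∃ (hx : x ∉ W) (p : (G.induce Wᶜ).Walk ⟨u, hu⟩ ⟨x, hx⟩), p.length ≤ k}

section Ball

variable {V : Type*} {G : SimpleGraph V} {W : Set V} {u : V} {hu : u ∉ W}

theorem ballAvoiding_mono : Monotone (ballAvoiding G W hu) := by
  rintro i j hij x ⟨hx, p, hp⟩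
  exact ⟨hx, p, hp.trans hij⟩

theorem mem_ballAvoiding_succ {k : ℕ} {x y : V} (hx : x ∈ ballAvoiding G W hu k)
    (hxy : G.Adj x y) (hy : y ∉ W) : y ∈ ballAvoiding G W hu (k + 1) := by
  obtain ⟨hxW, p, hp⟩ := hx
  have hadj : (G.induce Wᶜ).Adj ⟨x, hxW⟩ ⟨y, hy⟩ := hxy
  refine ⟨hy, p.concat hadj, ?_⟩
  rw [SimpleGraph.Walk.length_concat]
  omega

theorem neighborSet_diff_subset_ballAvoiding_one :
    G.neighborSet u \ W ⊆ ballAvoiding G W hu 1 := fun _ hx =>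
  mem_ballAvoiding_succ (k := 0) ⟨hu, SimpleGraph.Walk.nil, le_rfl⟩ hx.1 hx.2

theorem ncard_neighborSet_le [Finite V] :
    (G.neighborSet u).ncard ≤ (ballAvoiding G W hu 1).ncard + W.ncard := by
  have h := Set.ncard_le_ncard (neighborSet_diff_subset_ballAvoiding_one (G := G) (hu := hu))
  have h' := Set.ncard_le_ncard_sdiff_add_ncard (G.neighborSet u) W
  omega

theorem ncard_ballAvoiding_add_ncard_nbhd_le [Finite V] (k : ℕ) :
    (ballAvoiding G W hu k).ncard + (nbhd G (ballAvoiding G W hu k)).ncard ≤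
      (ballAvoiding G W hu (k + 1)).ncard + W.ncard := by
  set B := ballAvoiding G W hu k
  have hdisj : Disjoint B (nbhd G B \ W) :=
    Set.disjoint_left.2 fun x hx hx' => hx'.1.1 hx
  have hsub : B ∪ nbhd G B \ W ⊆ ballAvoiding G W hu (k + 1) := by
    rintro x (hx | ⟨⟨-, y, hy, hyx⟩, hxW⟩)
    · exact ballAvoiding_mono (Nat.le_succ k) hx
    · exact mem_ballAvoiding_succ hy hyx hxW
  have h := Set.ncard_le_ncard hsub
  rw [Set.ncard_union_eq hdisj] at h
  have h' := Set.ncard_le_ncard_sdiff_add_ncard (nbhd G B) W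
  omega

/-- Two balls that each contain more than half of the vertices yield a short path. -/
theorem exists_isPath_of_half_lt_ncard [Finite V] {v : V} {hv : v ∉ W} {i j : ℕ}
    (hi : (Nat.card V : ℝ) / 2 < (ballAvoiding G W hu i).ncard)
    (hj : (Nat.card V : ℝ) / 2 < (ballAvoiding G W hv j).ncard) :
    ∃ p : (G.induce Wᶜ).Walk ⟨u, hu⟩ ⟨v, hv⟩, p.IsPath ∧ p.length ≤ i + j := by
  classical
  have hmeet : ¬ Disjoint (ballAvoiding G W hu i) (ballAvoiding G W hv j) := by
    intro hdisj
    have h := Set.ncard_le_card (ballAvoiding G W hu i ∪ ballAvoiding G W hv j)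
    rw [Set.ncard_union_eq hdisj] at h
    have h' : ((ballAvoiding G W hu i).ncard : ℝ) + (ballAvoiding G W hv j).ncard ≤
        Nat.card V := by exact_mod_cast h
    linarith
  obtain ⟨x, ⟨hx, p, hp⟩, ⟨_, q, hq⟩⟩ := Set.not_disjoint_iff.1 hmeet
  refine ⟨(p.append q.reverse).bypass, SimpleGraph.Walk.bypass_isPath _, ?_⟩
  refine (SimpleGraph.Walk.length_bypass_le_length _).trans ?_
  rw [SimpleGraph.Walk.length_append, SimpleGraph.Walk.length_reverse]
  omega

end Ball

theorem le_logb_two_one_add {x : ℝ} (h0 : 0 ≤ x) (h1 : x ≤ 1) : x ≤ logb 2 (1 + x) := by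
  rw [Real.le_logb_iff_rpow_le one_lt_two (by linarith)]
  have h := rpow_one_add_le_one_add_mul_self (s := 1) (by norm_num) h0 h1
  norm_num at h
  exact h

/-- A `δ`-expander expands every set `S` of at most half of the vertices at a rate
proportional to `log (m / |S|)`. -/
theorem IsDeltaExpander.le_ncard_nbhd {V : Type*} [Finite V] {G : SimpleGraph V} {δ : ℝ}
    (hδ : 0 < δ) (hG : IsDeltaExpander G δ) (hl : 1 ≤ logb 2 (logb 2 (Nat.card V)))
    (hL : 0 < logb 2 (Nat.card V)) {S : Set V} (hS0 : 0 < S.ncard)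
    (hS : (S.ncard : ℝ) ≤ (Nat.card V : ℝ) / 2) :
    δ / (4 * logb 2 (Nat.card V) * logb 2 (logb 2 (Nat.card V)) ^ 2) *
      logb 2 ((Nat.card V : ℝ) / S.ncard) * S.ncard ≤ (nbhd G S).ncard := by
  set n : ℝ := (Nat.card V : ℝ)
  set s : ℝ := (S.ncard : ℝ)
  set L := logb 2 n
  set l := logb 2 L
  set a := logb 2 (n / s) with ha
  have hs1 : 1 ≤ s := Nat.one_le_cast.2 hS0
  have hs : 0 < s := by linarith
  have hn : 0 < n := by linarith
  have ha1 : 1 ≤ a := by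
    rw [ha, Real.le_logb_iff_rpow_le one_lt_two (by positivity), rpow_one, le_div_iff₀ hs]
    linarith
  have haL : a ≤ L := by
    apply Real.logb_le_logb_of_le one_lt_two (by positivity)
    exact div_le_self hn.le hs1
  have hla : 0 ≤ logb 2 a := Real.logb_nonneg one_lt_two ha1
  have hlal : logb 2 a ≤ l := Real.logb_le_logb_of_le one_lt_two (by linarith) haL
  have hfl := Nat.floor_le hla
  have hfl' := Nat.lt_floor_add_one (logb 2 a)
  obtain ⟨d, hd, hd0, hd2⟩ : ∃ d : ℕ, (d : ℝ) ≤ l - 1 ∧ (d : ℝ) ≤ logb 2 a ∧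
      logb 2 a ≤ d + 2 := by
    refine ⟨⌊logb 2 a⌋₊ - 1, ?_⟩
    rcases Nat.eq_zero_or_pos ⌊logb 2 a⌋₊ with h | h
    · rw [h] at hfl'
      rw [h]
      norm_num at hfl' ⊢
      exact ⟨hl, hla, by linarith⟩
    · rw [Nat.cast_sub h]
      push_cast
      exact ⟨by linarith, by linarith, by linarith⟩
  have hda : (2 : ℝ) ^ d ≤ a := by
    rwa [Real.le_logb_iff_rpow_le one_lt_two (by linarith), rpow_natCast] at hd0
  have had : a ≤ 4 * 2 ^ d := by
    rw [Real.logb_le_iff_le_rpow one_lt_two (by linarith), rpow_add two_pos,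
      rpow_natCast] at hd2
    norm_num at hd2
    linarith
  have hsize : s ≤ n / (2 : ℝ) ^ (2 ^ d : ℕ) := by
    rw [le_div_iff₀ (by positivity), mul_comm, ← le_div_iff₀ hs, ← rpow_natCast,
      ← Real.le_logb_iff_rpow_le one_lt_two (by positivity)]
    push_cast
    exact hda
  refine le_trans ?_ (hG d hd S hsize)
  refine mul_le_mul_of_nonneg_right ?_ hs.le
  have hl0 : 0 < l := by linarith
  calc δ / (4 * L * l ^ 2) * a ≤ δ / (4 * L * l ^ 2) * (4 * 2 ^ d) := by gcongr
    _ = δ * 2 ^ d / (L * l ^ 2) := by field_simp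

/-- If `δ` is not too small compared with `log m`, balls avoiding a small set `W` around a
vertex of large degree fill half of the graph within radius `O(log m (log log m)³)`. -/
theorem exists_half_lt_ncard_ballAvoiding {V : Type*} [Finite V] {G : SimpleGraph V} {δ L l : ℝ}
    (hδ : 0 < δ) (hG : IsDeltaExpander G δ) (hL : L = logb 2 (Nat.card V)) (hl : l = logb 2 L)
    (hl1 : 1 ≤ l) (hL2 : 2 ≤ L) (hlδ : δ ≤ 8 * l ^ 2) (hLδ : 16 * l ^ 2 ≤ δ * L)
    {W : Set V} (hW : (W.ncard : ℝ) ≤ L ^ 2) {u : V} (hu : u ∉ W)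
    (hdeg : L ^ 4 ≤ (G.neighborSet u).ncard) :
    ∃ k : ℕ, (k : ℝ) ≤ 8 / δ * L * l ^ 3 + 2 ∧
      (Nat.card V : ℝ) / 2 < (ballAvoiding G W hu k).ncard := by
  have hL0 : 0 < L := by linarith
  have hl0 : 0 < l := by linarith
  set c := δ / (8 * L * l ^ 2) with hc
  have hc0 : 0 < c := by positivity
  have hcL : c * L ≤ 1 := by
    rw [hc, div_mul_eq_mul_div, div_le_one (by positivity)]
    nlinarith
  have hlc : 8 / δ * L * l ^ 3 = l / c := by
    rw [hc]
    field_simp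
  rw [hlc]
  set K := ⌊l / c⌋₊ + 1 with hK
  refine ⟨K + 1, ?_, ?_⟩
  · rw [hK]
    push_cast
    linarith [Nat.floor_le (show 0 ≤ l / c by positivity)]
  by_contra! hsmall
  set b : ℕ → ℝ := fun k => (ballAvoiding G W hu (k + 1)).ncard with hb
  have hbmono : Monotone b := fun i j hij => by
    simp only [hb]
    exact_mod_cast Set.ncard_le_ncard (ballAvoiding_mono (Nat.succ_le_succ hij))
  have hb0 : L ^ 4 - L ^ 2 ≤ b 0 := by
    have h : ((G.neighborSet u).ncard : ℝ) ≤ b 0 + W.ncard := by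
      simp only [hb]
      exact_mod_cast ncard_neighborSet_le (G := G) (hu := hu)
    linarith
  have hblow : L ^ 4 / 2 ≤ b 0 := by
    have h4 : 4 * L ^ 2 ≤ L ^ 2 * L ^ 2 := by gcongr; nlinarith
    nlinarith
  have hbk (k : ℕ) : L ^ 4 / 2 ≤ b k := hblow.trans (hbmono (Nat.zero_le k))
  have hbpos (k : ℕ) : 0 < b k := lt_of_lt_of_le (by positivity) (hbk k)
  have hbhalf {k : ℕ} (hk : k ≤ K) : b k ≤ Nat.card V / 2 := (hbmono hk).trans hsmall
  have hn0 : 0 < (Nat.card V : ℝ) := by linarith [hbpos 0, hbhalf (Nat.zero_le K)]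
  set a : ℕ → ℝ := fun k => logb 2 (Nat.card V / b k) with ha
  have ha1 {k : ℕ} (hk : k ≤ K) : 1 ≤ a k := by
    have := hbpos k
    simp only [ha]
    rw [Real.le_logb_iff_rpow_le one_lt_two (by positivity), rpow_one, le_div_iff₀ this]
    linarith [hbhalf hk]
  have haL (k : ℕ) : a k ≤ L := by
    have hbone : 1 ≤ b k := by
      refine le_trans ?_ (hbk k)
      nlinarith [mul_pos hL0 hL0, sq_nonneg (L ^ 2 - 2)]
    rw [hL]
    apply Real.logb_le_logb_of_le one_lt_two (div_pos hn0 (hbpos k))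
    exact div_le_self hn0.le hbone
  have hstep {k : ℕ} (hk : k ≤ K) : a (k + 1) ≤ (1 - c) * a k := by
    have hak := ha1 hk
    have hexp := hG.le_ncard_nbhd hδ (by rw [← hL, ← hl]; exact hl1) (by rw [← hL]; exact hL0)
      (S := ballAvoiding G W hu (k + 1)) (Nat.cast_pos.1 (hbpos k)) (hbhalf hk)
    rw [← hL, ← hl] at hexp
    change δ / (4 * L * l ^ 2) * a k * b k ≤ _ at hexp
    have h2c : δ / (4 * L * l ^ 2) = 2 * c := by
      rw [hc]
      field_simp
      norm_num
    rw [h2c] at hexp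
    have hadd : b k + (nbhd G (ballAvoiding G W hu (k + 1))).ncard ≤ b (k + 1) + W.ncard := by
      simp only [hb]
      exact_mod_cast ncard_ballAvoiding_add_ncard_nbhd_le (G := G) (hu := hu) (k + 1)
    have hWc : L ^ 2 ≤ c * a k * b k := by
      calc L ^ 2 ≤ c * (L ^ 4 / 2) := by
            rw [hc, div_mul_eq_mul_div, le_div_iff₀ (by positivity)]
            nlinarith [pow_pos hL0 3]
        _ ≤ c * b k := by gcongr; exact hbk k
        _ ≤ c * a k * b k := by
            have := mul_pos hc0 (hbpos k)
            nlinarith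
    have hgrow : (1 + c * a k) * b k ≤ b (k + 1) := by nlinarith
    have hca : 0 < c * a k := mul_pos hc0 (by linarith)
    have hlog : c * a k ≤ logb 2 (1 + c * a k) :=
      le_logb_two_one_add hca.le (le_trans (by gcongr; exact haL k) hcL)
    have hdec : a (k + 1) ≤ a k - logb 2 (1 + c * a k) := by
      simp only [ha]
      rw [← Real.logb_div (div_pos hn0 (hbpos k)).ne' (by positivity), div_div]
      have := hbpos k
      apply Real.logb_le_logb_of_le one_lt_two (div_pos hn0 (hbpos (k + 1)))
      apply div_le_div_of_nonneg_left hn0.le (by positivity)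
      rw [mul_comm]
      exact hgrow
    linarith
  have hc1 : c ≤ 1 := by nlinarith
  have hdecay : ∀ k ≤ K, a k ≤ (1 - c) ^ k * L := by
    intro k
    induction k with
    | zero => intro _; simpa using haL 0
    | succ k ih =>
      intro hk
      calc a (k + 1) ≤ (1 - c) * a k := hstep (by omega)
        _ ≤ (1 - c) * ((1 - c) ^ k * L) :=
            mul_le_mul_of_nonneg_left (ih (by omega)) (by linarith)
        _ = (1 - c) ^ (k + 1) * L := by ring
  have hexp : 1 ≤ Real.exp (-(c * K)) * L := by
    refine (ha1 le_rfl).trans ((hdecay K le_rfl).trans ?_)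
    refine mul_le_mul_of_nonneg_right ?_ hL0.le
    calc (1 - c) ^ K ≤ Real.exp (-c) ^ K :=
          pow_le_pow_left₀ (by linarith) (Real.one_sub_le_exp_neg c) K
      _ = Real.exp (-(c * K)) := by
          rw [← Real.exp_nat_mul]
          ring_nf
  have hlogL : c * K ≤ Real.log L := by
    rw [Real.exp_neg, ← div_eq_inv_mul, le_div_iff₀ (Real.exp_pos _), one_mul] at hexp
    rwa [Real.le_log_iff_exp_le hL0]
  have hlogl : Real.log L ≤ l := by
    rw [hl, Real.logb, le_div_iff₀ (Real.log_pos one_lt_two)]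
    have := Real.log_nonneg (show (1 : ℝ) ≤ L by linarith)
    nlinarith [Real.log_two_lt_d9]
  have hKl : l / c < K := by
    rw [hK]
    push_cast
    exact Nat.lt_floor_add_one _
  rw [div_lt_iff₀ hc0] at hKl
  linarith

theorem eventually_sq_logb_two_le (ε : ℝ) (hε : 0 < ε) :
    ∀ᶠ x : ℝ in Filter.atTop, logb 2 x ^ 2 ≤ ε * x := by
  have hlog2 : 0 < Real.log 2 := Real.log_pos one_lt_two
  have h := (Real.isLittleO_pow_log_id_atTop (n := 2)).bound
    (show 0 < ε * Real.log 2 ^ 2 by positivity)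
  filter_upwards [h, Filter.eventually_ge_atTop 0] with x hx hx0
  rw [id, Real.norm_of_nonneg (sq_nonneg _), Real.norm_of_nonneg hx0] at hx
  rw [Real.logb, div_pow, div_le_iff₀ (by positivity)]
  linarith

/-- The main step in the proof of Claim 3.6: in a large `δ`-expander, any two distinct
vertices of degree at least `(log m)⁴` can be joined, avoiding any prescribed set `W` of at
most `(log m)²` vertices, by a path of length at most `(20/δ)·log m·(log log m)³`. -/
theorem stmt_16 :
    ∀ δ : ℝ, 0 < δ → ∃ m₀ : ℕ,
      ∀ m : ℕ, m₀ ≤ m → ∀ G : SimpleGraph (Fin m), IsDeltaExpander G δ →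
        ∀ u v : Fin m, u ≠ v →
          ((G.neighborSet u).ncard : ℝ) ≥ (logb 2 m) ^ 4 →
          ((G.neighborSet v).ncard : ℝ) ≥ (logb 2 m) ^ 4 →
          ∀ W : Set (Fin m), (W.ncard : ℝ) ≤ (logb 2 m) ^ 2 →
            ∀ (hu : u ∉ W) (hv : v ∉ W),
              ∃ p : (G.induce Wᶜ).Walk ⟨u, hu⟩ ⟨v, hv⟩, p.IsPath ∧
                (p.length : ℝ) ≤
                  (20 / δ) * logb 2 m * (logb 2 (logb 2 m)) ^ 3 := by
  intro δ hδ
  have hlogm : Filter.Tendsto (fun m : ℕ => logb 2 (m : ℝ)) Filter.atTop Filter.atTop :=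
    (Real.tendsto_logb_atTop one_lt_two).comp tendsto_natCast_atTop_atTop
  have hloglogm := (Real.tendsto_logb_atTop one_lt_two).comp hlogm
  obtain ⟨m₀, hm₀⟩ := Filter.eventually_atTop.1
    (((hlogm.eventually_ge_atTop (max 2 δ)).and (hloglogm.eventually_ge_atTop (max 1 δ))).and
      (hlogm.eventually (eventually_sq_logb_two_le (δ / 16) (by positivity))))
  refine ⟨m₀, fun m hm G hG u v _ hdu hdv W hW hu hv => ?_⟩
  obtain ⟨⟨hL, hl⟩, hLl⟩ := hm₀ m hm
  simp only [Function.comp_apply] at hl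
  set L := logb 2 (m : ℝ) with hLdef
  set l := logb 2 L with hldef
  obtain ⟨hL2, hLδ⟩ := max_le_iff.1 hL
  obtain ⟨hl1, hlδ⟩ := max_le_iff.1 hl
  have hcard : L = logb 2 (Nat.card (Fin m)) := by rw [Nat.card_fin]
  have hδl : δ ≤ 8 * l ^ 2 := by nlinarith
  have hlL : 16 * l ^ 2 ≤ δ * L := by linarith
  obtain ⟨i, hi, hBi⟩ := exists_half_lt_ncard_ballAvoiding hδ hG hcard hldef hl1 hL2 hδl hlL
    hW hu hdu
  obtain ⟨j, hj, hBj⟩ := exists_half_lt_ncard_ballAvoiding hδ hG hcard hldef hl1 hL2 hδl hlL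
    hW hv hdv
  obtain ⟨p, hp, hlen⟩ := exists_isPath_of_half_lt_ncard hBi hBj
  refine ⟨p, hp, ?_⟩
  have hlen' : (p.length : ℝ) ≤ i + j := by exact_mod_cast hlen
  have hone : 1 ≤ 1 / δ * L * l ^ 3 := by
    have hLl3 : δ * 1 ≤ L * l ^ 3 :=
      mul_le_mul hLδ (one_le_pow₀ hl1) zero_le_one (by linarith)
    rw [mul_assoc, one_div, ← div_eq_inv_mul, le_div_iff₀ hδ]
    linarith
  have h8 : 8 / δ * L * l ^ 3 = 8 * (1 / δ * L * l ^ 3) := by ring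
  have h20 : 20 / δ * L * l ^ 3 = 20 * (1 / δ * L * l ^ 3) := by ring
  rw [h8] at hi hj
  rw [h20]
  linarith
end
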